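/- arXiv:1410.4538 — 2 statements merged into one kernel-verified Lean document; each statement's English description precedes it below -/
import Mathlib

section
/- Let q be a positive integer and let a be an integer coprime to q. Then the fractional parts ⟨12·s(d,c)⟩, taken over all pairs (c,d) with c ≤ x, c ≡ a (mod q), and d running over residues modulo c coprime to c, become equidistributed in [0,1) as x → ∞: for all 0 ≤ α < β ≤ 1, the ratio #{(c,d) : c ≤ x, c ≡ a (mod q), 1 ≤ d ≤ c, gcd(d,c)=1, α ≤ ⟨12·s(d,c)⟩ < β} / #{(c,d) : c ≤ x, c ≡ a (mod q), 1 ≤ d ≤ c, gcd(d,c)=1} tends to β − α as x → ∞. -/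
open scoped BigOperators

/-- The sawtooth function `((x))`: `0` if `x ∈ ℤ`, and `x - ⌊x⌋ - 1/2` otherwise. -/
noncomputable def sawtooth (x : ℝ) : ℝ :=
  if (⌊x⌋ : ℝ) = x then 0 else x - ⌊x⌋ - 1/2

/-- The Dedekind sum `s(d,c) = Σ_{k=1}^{c-1} ((k/c)) ((kd/c))`. -/
noncomputable def dedekindSum (d : ℤ) (c : ℕ) : ℝ :=
  ∑ k ∈ Finset.Ico 1 c, sawtooth ((k : ℝ) / c) * sawtooth ((k : ℝ) * d / c)

/-- Number of pairs `(c,d)` with `1 ≤ c ≤ x`, `c ≡ a (mod q)`, `1 ≤ d ≤ c`, `(d,c)=1`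
and `α ≤ ⟨12 s(d,c)⟩ < β`. -/
noncomputable def dedekindCount (q : ℕ) (a : ℤ) (α β : ℝ) (x : ℕ) : ℕ :=
  ∑ c ∈ Finset.Icc 1 x, if (c : ℤ) % (q : ℤ) = a % (q : ℤ) then
    ((Finset.Icc 1 c).filter (fun d => Nat.Coprime d c ∧
      α ≤ Int.fract (12 * dedekindSum (d : ℤ) c) ∧
      Int.fract (12 * dedekindSum (d : ℤ) c) < β)).card
  else 0

/-- Number of pairs `(c,d)` with `1 ≤ c ≤ x`, `c ≡ a (mod q)`, `1 ≤ d ≤ c`, `(d,c)=1`. -/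
noncomputable def dedekindTotal (q : ℕ) (a : ℤ) (x : ℕ) : ℕ :=
  ∑ c ∈ Finset.Icc 1 x, if (c : ℤ) % (q : ℤ) = a % (q : ℤ) then
    ((Finset.Icc 1 c).filter (fun d => Nat.Coprime d c)).card
  else 0

open Filter Topology MeasureTheory
open scoped ComplexConjugate

theorem exists_card_divisors_le_rpow {ε : ℝ} (hε : 0 < ε) :
    ∃ C : ℝ, 0 < C ∧ ∀ n : ℕ, n ≠ 0 → (n.divisors.card : ℝ) ≤ C * (n : ℝ) ^ ε := by
  set P : ℕ := ⌈(2 : ℝ) ^ (1 / ε)⌉₊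
  have hl : 0 < ε * Real.log 2 := mul_pos hε (Real.log_pos one_lt_two)
  set A : ℝ := 1 + 1 / (ε * Real.log 2)
  have hA : 1 ≤ A := by simp only [A]; linarith [one_div_pos.2 hl]
  have hA0 : 0 < A := by linarith
  have key (p : ℕ) (hp : p.Prime) (k : ℕ) :
      ((k : ℝ) + 1) ≤ (if p < P then A else 1) * ((p : ℝ) ^ k) ^ ε := by
    have hp2 : (2 : ℝ) ≤ p := by exact_mod_cast hp.two_le
    have hcomm : ((p : ℝ) ^ k) ^ ε = ((p : ℝ) ^ ε) ^ k := by
      rw [← Real.rpow_natCast, ← Real.rpow_natCast, ← Real.rpow_mul (by positivity),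
        ← Real.rpow_mul (by positivity), mul_comm]
    rw [hcomm]
    split_ifs with h
    · have h1 : ((2 : ℝ) ^ ε) ^ k ≤ ((p : ℝ) ^ ε) ^ k := by gcongr
      have h2 : 1 + (k : ℝ) * (ε * Real.log 2) ≤ ((2 : ℝ) ^ ε) ^ k := by
        rw [Real.rpow_def_of_pos two_pos, ← Real.exp_nat_mul]
        have := Real.add_one_le_exp ((k : ℝ) * (Real.log 2 * ε))
        linarith
      have h3 : (k : ℝ) + 1 ≤ A * (1 + (k : ℝ) * (ε * Real.log 2)) := by
        have : A * (1 + (k : ℝ) * (ε * Real.log 2)) =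
            1 + 1 / (ε * Real.log 2) + k * (ε * Real.log 2) + k := by
          simp only [A]; field_simp; ring
        rw [this]
        have := one_div_pos.2 hl
        have : 0 ≤ k * (ε * Real.log 2) := by positivity
        linarith
      exact h3.trans (by gcongr; exact h2.trans h1)
    · have hP : (2 : ℝ) ^ (1 / ε) ≤ p := (Nat.le_ceil _).trans (by exact_mod_cast not_lt.1 h)
      have h1 : (2 : ℝ) ≤ (p : ℝ) ^ ε := by
        calc (2 : ℝ) = ((2 : ℝ) ^ (1 / ε)) ^ ε := by
              rw [← Real.rpow_mul (by norm_num), one_div_mul_cancel hε.ne', Real.rpow_one]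
          _ ≤ _ := by gcongr
      have h2 : (k : ℝ) + 1 ≤ 2 ^ k := by exact_mod_cast Nat.lt_two_pow_self
      rw [one_mul]
      exact h2.trans (by gcongr)
  refine ⟨A ^ P, by positivity, fun n hn => ?_⟩
  have hprod : (n : ℝ) ^ ε = ∏ p ∈ n.primeFactors, ((p : ℝ) ^ n.factorization p) ^ ε := by
    rw [Real.finsetProd_rpow _ _ (fun p _ => by positivity)]
    congr 1
    exact_mod_cast (Nat.prod_factorization_pow_eq_self hn).symm
  rw [Nat.card_divisors hn, hprod]
  push_cast
  calc _ ≤ ∏ p ∈ n.primeFactors, (if p < P then A else 1) * ((p : ℝ) ^ n.factorization p) ^ ε :=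
        Finset.prod_le_prod (fun p _ => by positivity)
          (fun p hp => key p (Nat.prime_of_mem_primeFactors hp) _)
    _ = (∏ p ∈ n.primeFactors, if p < P then A else 1) *
          ∏ p ∈ n.primeFactors, ((p : ℝ) ^ n.factorization p) ^ ε := Finset.prod_mul_distrib
    _ ≤ _ := by
      gcongr
      rw [Finset.prod_ite, Finset.prod_const, Finset.prod_const_one, mul_one]
      refine pow_le_pow_right₀ hA ?_
      calc _ ≤ (Finset.range P).card := Finset.card_le_card (fun p hp => by simp_all)
        _ = P := Finset.card_range P

theorem le_card_divisors_mul_totient (n : ℕ) : n ≤ n.divisors.card * n.totient := by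
  rcases Nat.eq_zero_or_pos n with rfl | hn
  · simp
  calc n = ∑ d ∈ n.divisors, d.totient := (Nat.sum_totient n).symm
    _ ≤ ∑ d ∈ n.divisors, n.totient := Finset.sum_le_sum fun d hd =>
        Nat.le_of_dvd (Nat.totient_pos.2 hn) (Nat.totient_dvd_of_dvd (Nat.dvd_of_mem_divisors hd))
    _ = _ := by simp

/-- A ratio of partial sums converges to the limit of the ratios of the terms. -/
theorem tendsto_sum_div_sum_of_tendsto_div {f g : ℕ → ℝ} {L : ℝ} {S : ℕ → Prop} [DecidablePred S]
    (hg : ∀ n, 0 < n → S n → 0 < g n)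
    (hsum : Tendsto (fun x : ℕ => ∑ c ∈ Finset.Icc 1 x, if S c then g c else 0) atTop atTop)
    (h : Tendsto (fun n => f n / g n) atTop (𝓝 L)) :
    Tendsto (fun x : ℕ => (∑ c ∈ Finset.Icc 1 x, if S c then f c else 0) /
      (∑ c ∈ Finset.Icc 1 x, if S c then g c else 0)) atTop (𝓝 L) := by
  have hrange (F : ℕ → ℝ) (x : ℕ) :
      ∑ c ∈ Finset.Icc 1 x, F c = ∑ c ∈ Finset.range x, F (c + 1) := by
    rw [Finset.range_eq_Ico, Finset.sum_Ico_add' F 0 x 1]; rfl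
  simp only [hrange] at hsum ⊢
  set G : ℕ → ℝ := fun c => if S (c + 1) then g (c + 1) else 0 with hG
  set F : ℕ → ℝ := fun c => if S (c + 1) then f (c + 1) else 0 with hF
  have ho : (fun c => F c - L * G c) =o[atTop] G := by
    have h1 : Tendsto (fun n => f (n + 1) / g (n + 1) - L) atTop (𝓝 0) := by
      simpa using ((tendsto_add_atTop_iff_nat 1).2 h).sub_const L
    have h2 : (fun c => F c - L * G c) = fun n => (f (n + 1) / g (n + 1) - L) * G n := by
      funext n
      simp only [hF, hG]
      split_ifs with hs
      · have := (hg _ n.succ_pos hs).ne'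
        field_simp
      · simp
    rw [h2]
    simpa using ((Asymptotics.isLittleO_one_iff ℝ).2 h1).mul_isBigO
      (Asymptotics.isBigO_refl G atTop)
  have hG0 (n : ℕ) : 0 ≤ G n := by
    simp only [hG]; split_ifs with hs
    · exact (hg _ n.succ_pos hs).le
    · exact le_rfl
  have h3 := (ho.sum_range hG0 hsum).tendsto_div_nhds_zero
  have h4 := h3.add_const L
  rw [zero_add] at h4
  refine h4.congr' ?_
  filter_upwards [hsum.eventually_gt_atTop 0] with x hx
  rw [Finset.sum_sub_distrib, ← Finset.mul_sum]
  field_simp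
  ring

theorem haarAddCircle_eq_volume : (AddCircle.haarAddCircle : Measure UnitAddCircle) = volume := by
  rw [AddCircle.volume_eq_smul_haarAddCircle]; simp

theorem integral_fourier_of_ne_zero {m : ℤ} (hm : m ≠ 0) :
    ∫ x : UnitAddCircle, fourier m x ∂AddCircle.haarAddCircle = 0 := by
  have h := congrFun (fourierCoeff_fourier (T := 1) m) 0
  simpa [fourierCoeff, Pi.single_apply, hm.symm] using h

theorem coe_unitAddCircle_mem_image_Ico_iff {α β : ℝ} (h0 : 0 ≤ α) (h1 : β ≤ 1) (x : ℝ) :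
    (x : UnitAddCircle) ∈ ((↑) : ℝ → UnitAddCircle) '' Set.Ico α β ↔
      α ≤ Int.fract x ∧ Int.fract x < β := by
  have hx : ((Int.fract x : ℝ) : UnitAddCircle) = x := by
    rw [← Int.self_sub_floor, AddCircle.coe_sub, sub_eq_self]
    exact (AddCircle.coe_eq_zero_iff 1).2 ⟨⌊x⌋, by simp⟩
  constructor
  · rintro ⟨y, hy, hyx⟩
    rw [← hx] at hyx
    have hyf : y = Int.fract x :=
      (AddCircle.coe_eq_coe_iff_of_mem_Ico (p := (1 : ℝ)) (a := 0)
        ⟨h0.trans hy.1, by simpa using hy.2.trans_le h1⟩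
        ⟨Int.fract_nonneg x, by simpa using Int.fract_lt_one x⟩).1 hyx
    rw [← hyf]
    exact hy
  · intro h
    exact ⟨Int.fract x, h, hx⟩

theorem frontier_image_Ico_subset (α β : ℝ) :
    frontier (((↑) : ℝ → UnitAddCircle) '' Set.Ico α β) ⊆ {(α : UnitAddCircle), (β : UnitAddCircle)} := by
  rintro x ⟨hx, hx'⟩
  have hcl : closure (((↑) : ℝ → UnitAddCircle) '' Set.Ico α β) ⊆
      ((↑) : ℝ → UnitAddCircle) '' Set.Icc α β :=
    closure_minimal (Set.image_mono Set.Ico_subset_Icc_self)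
      (isCompact_Icc.image (AddCircle.continuous_mk' 1)).isClosed
  have hint : ((↑) : ℝ → UnitAddCircle) '' Set.Ioo α β ⊆
      interior (((↑) : ℝ → UnitAddCircle) '' Set.Ico α β) :=
    interior_maximal (Set.image_mono Set.Ioo_subset_Ico_self)
      (QuotientAddGroup.isOpenMap_coe _ isOpen_Ioo)
  obtain ⟨y, hy, rfl⟩ := hcl hx
  rcases eq_or_lt_of_le hy.1 with h | h
  · left; rw [h]
  rcases eq_or_lt_of_le hy.2 with h' | h'
  · right; rw [h']; rfl
  exact absurd (hint ⟨y, ⟨h, h'⟩, rfl⟩) hx'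

theorem volume_frontier_image_Ico (α β : ℝ) :
    volume (frontier (((↑) : ℝ → UnitAddCircle) '' Set.Ico α β)) = 0 := by
  have hsing (z : UnitAddCircle) : volume ({z} : Set UnitAddCircle) = 0 := by
    have := AddCircle.volume_closedBall (T := 1) (x := z) 0
    simpa using this
  refine measure_mono_null (frontier_image_Ico_subset α β) ?_
  rw [Set.insert_eq]
  exact measure_union_null (hsing _) (hsing _)

theorem volume_image_Ico {α β : ℝ} (h0 : 0 ≤ α) (h1 : β ≤ 1) :
    volume (((↑) : ℝ → UnitAddCircle) '' Set.Ico α β) = ENNReal.ofReal (β - α) := by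
  set A := ((↑) : ℝ → UnitAddCircle) '' Set.Ico α β with hA
  have hnull : NullMeasurableSet A := nullMeasurableSet_of_null_frontier (volume_frontier_image_Ico α β)
  have hmp := UnitAddCircle.measurePreserving_mk 0
  rw [← hmp.measure_preimage hnull, Measure.restrict_apply' measurableSet_Ioc,
    ← Real.volume_Ico]
  refine measure_congr ?_
  have h1ae : ∀ᵐ x : ℝ, x ≠ 1 := by simp [ae_iff]
  have h0ae : ∀ᵐ x : ℝ, x ≠ 0 := by simp [ae_iff]
  filter_upwards [h1ae, h0ae] with x hx1 hx0
  refine propext ?_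
  change ((x : UnitAddCircle) ∈ A ∧ x ∈ Set.Ioc (0 : ℝ) (0 + 1)) ↔ x ∈ Set.Ico α β
  rw [hA, coe_unitAddCircle_mem_image_Ico_iff h0 h1, zero_add]
  constructor
  · rintro ⟨h, hx⟩
    rwa [Int.fract_eq_self.2 ⟨hx.1.le, lt_of_le_of_ne hx.2 hx1⟩] at h
  · intro h
    have hx : 0 ≤ x ∧ x < 1 := ⟨h0.trans h.1, h.2.trans_le h1⟩
    rw [Int.fract_eq_self.2 hx]
    exact ⟨h, lt_of_le_of_ne hx.1 hx0.symm, hx.2.le⟩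

/-- The uniform probability measure on the points `θ i`, `i ∈ s`, of the circle. -/
noncomputable def empiricalMeasure {ι : Type*} (s : Finset ι) (θ : ι → ℝ) : Measure UnitAddCircle :=
  (s.card : ENNReal)⁻¹ • ∑ i ∈ s, Measure.dirac (θ i : UnitAddCircle)

theorem isProbabilityMeasure_empiricalMeasure {ι : Type*} {s : Finset ι} (hs : s.Nonempty)
    (θ : ι → ℝ) : IsProbabilityMeasure (empiricalMeasure s θ) := by
  refine ⟨?_⟩
  simp [empiricalMeasure]
  exact ENNReal.inv_mul_cancel (by simpa using hs.ne_empty) (by simp)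

theorem integral_empiricalMeasure {ι : Type*} (s : Finset ι) (θ : ι → ℝ)
    (f : C(UnitAddCircle, ℂ)) :
    ∫ x, f x ∂(empiricalMeasure s θ) = (∑ i ∈ s, f (θ i)) / s.card := by
  rw [empiricalMeasure, integral_smul_measure, integral_finsetSum_measure]
  · simp [div_eq_inv_mul]
  · intro i _
    exact integrable_dirac (by simp)

/-- **Weyl's criterion** for finite families of points in the circle. -/
theorem tendsto_card_filter_fract_div_card {ι : Type*} (s : ℕ → Finset ι) (θ : ℕ → ι → ℝ)
    (hs : ∀ n, (s n).Nonempty)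
    (h : ∀ m : ℤ, m ≠ 0 → Tendsto
      (fun n => (∑ i ∈ s n, fourier m (θ n i : UnitAddCircle)) / ((s n).card : ℂ)) atTop (𝓝 0))
    {α β : ℝ} (h0 : 0 ≤ α) (hαβ : α ≤ β) (h1 : β ≤ 1) :
    Tendsto (fun n => (((s n).filter fun i => α ≤ Int.fract (θ n i) ∧ Int.fract (θ n i) < β).card : ℝ)
      / (s n).card) atTop (𝓝 (β - α)) := by
  let μs : ℕ → ProbabilityMeasure UnitAddCircle := fun n =>
    ⟨empiricalMeasure (s n) (θ n), isProbabilityMeasure_empiricalMeasure (hs n) _⟩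
  let μ : ProbabilityMeasure UnitAddCircle := ⟨AddCircle.haarAddCircle, inferInstance⟩
  have hint (ν : ProbabilityMeasure UnitAddCircle) (f : C(UnitAddCircle, ℂ)) :
      Integrable f (ν : Measure UnitAddCircle) :=
    (BoundedContinuousFunction.mkOfCompact f).integrable _
  have hcont (f : C(UnitAddCircle, ℂ)) :
      Tendsto (fun n => ∫ x, f x ∂(μs n : Measure UnitAddCircle)) atTop
        (𝓝 (∫ x, f x ∂(μ : Measure UnitAddCircle))) := by
    have hf : f ∈ (Submodule.span ℂ (Set.range (fourier (T := 1)))).topologicalClosure := by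
      rw [span_fourier_closure_eq_top]; trivial
    rw [Metric.tendsto_atTop]
    intro ε hε
    obtain ⟨g, hg, hfg⟩ := Metric.mem_closure_iff.1 hf (ε / 3) (by positivity)
    have hgt : Tendsto (fun n => ∫ x, g x ∂(μs n : Measure UnitAddCircle)) atTop
        (𝓝 (∫ x, g x ∂(μ : Measure UnitAddCircle))) := by
      clear hfg
      induction hg using Submodule.span_induction with
      | mem x hx =>
        obtain ⟨m, rfl⟩ := hx
        rcases eq_or_ne m 0 with rfl | hm
        · simp
        · have := h m hm
          simp only [μ, ProbabilityMeasure.coe_mk, integral_fourier_of_ne_zero hm]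
          refine this.congr fun n => ?_
          simp only [μs, ProbabilityMeasure.coe_mk, integral_empiricalMeasure]
      | zero => simp
      | add x y _ _ hx hy =>
        simp only [ContinuousMap.add_apply]
        simp_rw [integral_add (hint _ x) (hint _ y)]
        exact hx.add hy
      | smul a x _ hx =>
        simp only [ContinuousMap.smul_apply, integral_smul]
        exact hx.const_smul a
    obtain ⟨N, hN⟩ := Metric.tendsto_atTop.1 hgt (ε / 3) (by positivity)
    have hclose (ν : ProbabilityMeasure UnitAddCircle) :
        dist (∫ x, f x ∂(ν : Measure UnitAddCircle)) (∫ x, g x ∂(ν : Measure UnitAddCircle)) ≤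
          ε / 3 := by
      rw [dist_eq_norm, ← integral_sub (hint _ f) (hint _ g)]
      refine (norm_integral_le_of_norm_le_const (C := ε / 3) (ae_of_all _ fun x => ?_)).trans ?_
      · rw [← dist_eq_norm]; exact (ContinuousMap.dist_apply_le_dist x).trans hfg.le
      · simp
    refine ⟨N, fun n hn => ?_⟩
    have a1 := hclose (μs n)
    have a2 := hclose μ
    have a3 := hN n hn
    rw [dist_comm] at a2
    calc _ ≤ _ := dist_triangle4 _ _ _ _
      _ < ε := by linarith
  have hμ : Tendsto μs atTop (𝓝 μ) :=
    (ProbabilityMeasure.tendsto_iff_forall_integral_rclike_tendsto ℂ).2 fun f =>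
      hcont f.toContinuousMap
  set A := ((↑) : ℝ → UnitAddCircle) '' Set.Ico α β with hA
  have hfr : (μ : Measure UnitAddCircle) (frontier A) = 0 := by
    simp only [μ, ProbabilityMeasure.coe_mk, haarAddCircle_eq_volume]
    exact volume_frontier_image_Ico α β
  have hlim := ProbabilityMeasure.tendsto_measure_of_null_frontier_of_tendsto' hμ hfr
  have hμA : (μ : Measure UnitAddCircle) A = ENNReal.ofReal (β - α) := by
    simp only [μ, ProbabilityMeasure.coe_mk, haarAddCircle_eq_volume]
    exact volume_image_Ico h0 h1
  rw [hμA] at hlim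
  have hlim' := (ENNReal.tendsto_toReal (by simp)).comp hlim
  rw [ENNReal.toReal_ofReal (by linarith)] at hlim'
  refine hlim'.congr fun n => ?_
  have hAm : MeasurableSet A := by
    have : A = {x | α ≤ ((AddCircle.measurableEquivIco 1 0 x : ℝ)) ∧
        ((AddCircle.measurableEquivIco 1 0 x : ℝ)) < β} := by
      ext x
      obtain ⟨y, rfl⟩ := QuotientAddGroup.mk_surjective x
      rw [hA]
      refine (coe_unitAddCircle_mem_image_Ico_iff h0 h1 y).trans ?_
      have : ((AddCircle.measurableEquivIco 1 0 (y : UnitAddCircle) : ℝ)) = Int.fract y := by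
        change ((AddCircle.equivIco 1 0 (y : UnitAddCircle) : ℝ)) = _
        rw [AddCircle.coe_equivIco_mk_apply]; simp
      simp only [Set.mem_ofPred_eq]
      rw [← this]
    rw [this]
    have hm : Measurable fun x : UnitAddCircle => (AddCircle.measurableEquivIco 1 0 x : ℝ) :=
      measurable_subtype_coe.comp (AddCircle.measurableEquivIco 1 0).measurable
    exact (measurableSet_le measurable_const hm).inter (measurableSet_lt hm measurable_const)
  classical
  simp only [Function.comp, μs, ProbabilityMeasure.coe_mk, empiricalMeasure, Measure.smul_apply,
    Measure.coe_finsetSum, Finset.sum_apply, Measure.dirac_apply' _ hAm, smul_eq_mul,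
    ENNReal.toReal_mul, ENNReal.toReal_inv, ENNReal.toReal_natCast, Set.indicator_apply,
    Pi.one_apply]
  rw [Finset.sum_ite, Finset.sum_const_zero, add_zero, Finset.sum_const, nsmul_one,
    ENNReal.toReal_natCast, div_eq_inv_mul]
  congr 3
  exact Finset.filter_congr fun i _ => coe_unitAddCircle_mem_image_Ico_iff h0 h1 _

/-- The Kloosterman sum `∑ e((u x + v x⁻¹) / c)` over the units `x` modulo `c`. -/
noncomputable def kloostermanSum {c : ℕ} [NeZero c] (u v : ZMod c) : ℂ :=
  ∑ x : (ZMod c)ˣ, ZMod.stdAddChar (u * (x : ZMod c) + v * ((x⁻¹ : (ZMod c)ˣ) : ZMod c))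

theorem conj_stdAddChar {c : ℕ} [NeZero c] (x : ZMod c) :
    conj (ZMod.stdAddChar x : ℂ) = ZMod.stdAddChar (-x) :=
  (AddChar.map_neg_eq_conj _ _).symm

/-- Second moment of a family of exponential sums over all pairs of frequencies. -/
theorem sum_sum_sq_norm_sum_stdAddChar {c : ℕ} [NeZero c] {P : Type*} [Fintype P]
    (a b : P → ZMod c) :
    ∑ u : ZMod c, ∑ v : ZMod c, ‖∑ p, (ZMod.stdAddChar (u * a p + v * b p) : ℂ)‖ ^ 2 =
      (c : ℝ) ^ 2 * (Finset.univ.filter fun p : P × P => a p.1 = a p.2 ∧ b p.1 = b p.2).card := by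
  classical
  have horth (t : ZMod c) : ∑ u : ZMod c, (ZMod.stdAddChar (u * t) : ℂ) = if t = 0 then (c : ℂ) else 0 := by
    rw [AddChar.sum_mulShift t (ZMod.isPrimitive_stdAddChar c)]
    split_ifs <;> simp
  have hterm (u v : ZMod c) :
      ((‖∑ p, (ZMod.stdAddChar (u * a p + v * b p) : ℂ)‖ ^ 2 : ℝ) : ℂ) =
        ∑ p : P × P, (ZMod.stdAddChar (u * (a p.1 - a p.2)) : ℂ) *
          ZMod.stdAddChar (v * (b p.1 - b p.2)) := by
    push_cast
    rw [← Complex.mul_conj', map_sum, Finset.sum_mul_sum, Fintype.sum_prod_type]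
    refine Finset.sum_congr rfl fun p _ => Finset.sum_congr rfl fun p' _ => ?_
    rw [conj_stdAddChar, ← AddChar.map_add_eq_mul, ← AddChar.map_add_eq_mul]
    congr 1
    ring
  have : ((∑ u : ZMod c, ∑ v : ZMod c, ‖∑ p, (ZMod.stdAddChar (u * a p + v * b p) : ℂ)‖ ^ 2 : ℝ) : ℂ)
      = (((c : ℝ) ^ 2 *
        (Finset.univ.filter fun p : P × P => a p.1 = a p.2 ∧ b p.1 = b p.2).card : ℝ) : ℂ) := by
    rw [Complex.ofReal_sum]
    simp_rw [Complex.ofReal_sum, hterm]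
    calc _ = ∑ p : P × P, (∑ u : ZMod c, (ZMod.stdAddChar (u * (a p.1 - a p.2)) : ℂ)) *
          ∑ v : ZMod c, (ZMod.stdAddChar (v * (b p.1 - b p.2)) : ℂ) := by
          simp_rw [Finset.sum_mul_sum]
          rw [Finset.sum_comm' (t' := Finset.univ) (s' := fun _ => Finset.univ) (by simp)]
          rw [Finset.sum_comm]
          conv_rhs => rw [Finset.sum_comm]
          refine Finset.sum_congr rfl fun v _ => ?_
          rw [Finset.sum_comm]
      _ = ∑ p : P × P, if a p.1 = a p.2 ∧ b p.1 = b p.2 then (c : ℂ) ^ 2 else 0 := by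
          refine Finset.sum_congr rfl fun p _ => ?_
          rw [horth, horth]
          simp only [sub_eq_zero]
          by_cases h1 : a p.1 = a p.2 <;> by_cases h2 : b p.1 = b p.2 <;> simp [h1, h2, sq]
      _ = _ := by
          rw [Finset.sum_ite, Finset.sum_const_zero, add_zero, Finset.sum_const, nsmul_eq_mul]
          push_cast
          ring
  exact_mod_cast this

theorem kloostermanSum_mul_unit {c : ℕ} [NeZero c] (u v : ZMod c) (t : (ZMod c)ˣ) :
    kloostermanSum (u * (t : ZMod c)) (v * ((t⁻¹ : (ZMod c)ˣ) : ZMod c)) = kloostermanSum u v := by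
  unfold kloostermanSum
  refine Fintype.sum_equiv (Equiv.mulLeft t) _ _ fun x => ?_
  simp only [Equiv.coe_mulLeft, Units.val_mul, mul_inv_rev]
  congr 1
  ring

theorem card_filter_mul_eq_le {c : ℕ} [NeZero c] {m : ℤ} (hm : m ≠ 0) (y : ZMod c) :
    (Finset.univ.filter fun x : ZMod c => (m : ZMod c) * x = y).card ≤ m.natAbs := by
  classical
  rcases Finset.eq_empty_or_nonempty (Finset.univ.filter fun x : ZMod c => (m : ZMod c) * x = y)
    with h | ⟨x₀, hx₀⟩
  · simp [h]
  refine le_trans ?_ (IsAddCyclic.card_nsmul_eq_zero_le (α := ZMod c) (Int.natAbs_pos.2 hm))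
  refine Finset.card_le_card_of_injOn (fun x => x - x₀) ?_ (fun x _ x' _ h => by simpa using h)
  intro x hx
  simp only [Finset.coe_filter, Finset.mem_filter, Finset.mem_univ, true_and, Set.mem_ofPred_eq] at hx hx₀ ⊢
  have h0 : (m : ZMod c) * (x - x₀) = 0 := by rw [mul_sub, hx, hx₀, sub_self]
  rw [nsmul_eq_mul]
  rcases Int.natAbs_eq m with h | h
  · rw [h] at h0; simpa using h0
  · rw [h] at h0; simpa using h0

theorem totient_mul_norm_kloostermanSum_pow_four_le {c : ℕ} [NeZero c] {m : ℤ} (hm : m ≠ 0) :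
    (c.totient : ℝ) * ‖kloostermanSum (m : ZMod c) m‖ ^ 4 ≤
      m.natAbs * ∑ u : ZMod c, ∑ v : ZMod c, ‖kloostermanSum u v‖ ^ 4 := by
  classical
  let g : (ZMod c)ˣ → ZMod c × ZMod c := fun t => ((m : ZMod c) * (t : ZMod c), (m : ZMod c) * ((t⁻¹ : (ZMod c)ˣ) : ZMod c))
  let F : ZMod c × ZMod c → ℝ := fun y => ‖kloostermanSum y.1 y.2‖ ^ 4
  have hfib (y : ZMod c × ZMod c) : (Finset.univ.filter fun t => g t = y).card ≤ m.natAbs := by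
    refine le_trans ?_ (card_filter_mul_eq_le hm y.1)
    refine Finset.card_le_card_of_injOn (fun t => (t : ZMod c)) ?_ (fun x _ x' _ h => Units.ext h)
    intro t ht
    simp only [Finset.coe_filter, Finset.mem_univ, true_and, Set.mem_ofPred_eq] at ht ⊢
    rw [← ht]
  calc (c.totient : ℝ) * ‖kloostermanSum (m : ZMod c) m‖ ^ 4 = ∑ t : (ZMod c)ˣ, F (g t) := by
        simp only [F, g, kloostermanSum_mul_unit, Finset.sum_const, Finset.card_univ,
          ZMod.card_units_eq_totient, nsmul_eq_mul]
    _ = ∑ y, ∑ t with g t = y, F (g t) := (Finset.sum_fiberwise _ _ _).symm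
    _ = ∑ y, ((Finset.univ.filter fun t => g t = y).card : ℝ) * F y := by
        refine Finset.sum_congr rfl fun y _ => ?_
        rw [Finset.sum_congr rfl (g := fun _ => F y) (fun t ht => by
          rw [(Finset.mem_filter.1 ht).2]), Finset.sum_const, nsmul_eq_mul]
    _ ≤ ∑ y, (m.natAbs : ℝ) * F y := by
        refine Finset.sum_le_sum fun y _ => ?_
        have : ((Finset.univ.filter fun t => g t = y).card : ℝ) ≤ m.natAbs := by exact_mod_cast hfib y
        have : 0 ≤ F y := by positivity
        gcongr
    _ = _ := by rw [← Finset.mul_sum, Fintype.sum_prod_type]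

theorem sum_sum_norm_kloostermanSum_pow_four {c : ℕ} [NeZero c] :
    ∑ u : ZMod c, ∑ v : ZMod c, ‖kloostermanSum u v‖ ^ 4 =
      (c : ℝ) ^ 2 * (Finset.univ.filter fun p : ((ZMod c)ˣ × (ZMod c)ˣ) × ((ZMod c)ˣ × (ZMod c)ˣ) =>
        (p.1.1 : ZMod c) + p.1.2 = p.2.1 + p.2.2 ∧
        ((p.1.1⁻¹ : (ZMod c)ˣ) : ZMod c) + ((p.1.2⁻¹ : (ZMod c)ˣ) : ZMod c) =
          ((p.2.1⁻¹ : (ZMod c)ˣ) : ZMod c) + ((p.2.2⁻¹ : (ZMod c)ˣ) : ZMod c)).card := by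
  rw [← sum_sum_sq_norm_sum_stdAddChar (P := (ZMod c)ˣ × (ZMod c)ˣ)
    (fun p => (p.1 : ZMod c) + (p.2 : ZMod c))
    (fun p => ((p.1⁻¹ : (ZMod c)ˣ) : ZMod c) + ((p.2⁻¹ : (ZMod c)ˣ) : ZMod c))]
  refine Finset.sum_congr rfl fun u _ => Finset.sum_congr rfl fun v _ => ?_
  rw [show (4 : ℕ) = 2 * 2 from rfl, pow_mul, ← norm_pow, sq (kloostermanSum u v)]
  congr 2
  unfold kloostermanSum
  rw [Finset.sum_mul_sum, Fintype.sum_prod_type]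
  refine Finset.sum_congr rfl fun x _ => Finset.sum_congr rfl fun y _ => ?_
  rw [← AddChar.map_add_eq_mul]
  congr 1
  ring

theorem card_kloosterman_quadruples_le {c : ℕ} [NeZero c] :
    (Finset.univ.filter fun p : ((ZMod c)ˣ × (ZMod c)ˣ) × ((ZMod c)ˣ × (ZMod c)ˣ) =>
        (p.1.1 : ZMod c) + p.1.2 = p.2.1 + p.2.2 ∧
        ((p.1.1⁻¹ : (ZMod c)ˣ) : ZMod c) + ((p.1.2⁻¹ : (ZMod c)ˣ) : ZMod c) =
          ((p.2.1⁻¹ : (ZMod c)ˣ) : ZMod c) + ((p.2.2⁻¹ : (ZMod c)ˣ) : ZMod c)).card ≤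
      c.totient * (Finset.univ.filter fun y : ZMod c × ZMod c =>
        (y.1 + y.2) * ((1 - y.1) * (1 - y.2)) = 0).card := by
  classical
  rw [← ZMod.card_units_eq_totient, ← Finset.card_univ, ← Finset.card_product]
  refine Finset.card_le_card_of_injOn (fun p => (p.2.1,
    ((p.1.1 : ZMod c) * (p.2.1⁻¹ : (ZMod c)ˣ), (p.1.2 : ZMod c) * (p.2.1⁻¹ : (ZMod c)ˣ)))) ?_ ?_
  · rintro ⟨⟨x1, x2⟩, ⟨x3, x4⟩⟩ h
    simp only [Finset.coe_filter, Finset.mem_univ, true_and, Set.mem_ofPred_eq, Finset.coe_product,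
      Finset.coe_univ, Set.mem_prod, Set.mem_univ] at h ⊢
    obtain ⟨h1, h2⟩ := h
    have e1 := x1.mul_inv
    have e2 := x2.mul_inv
    have e3 := x3.mul_inv
    have e4 := x4.mul_inv
    generalize ((x1⁻¹ : (ZMod c)ˣ) : ZMod c) = z1 at *
    generalize ((x2⁻¹ : (ZMod c)ˣ) : ZMod c) = z2 at *
    generalize ((x3⁻¹ : (ZMod c)ˣ) : ZMod c) = z3 at *
    generalize ((x4⁻¹ : (ZMod c)ˣ) : ZMod c) = z4 at *
    generalize (x1 : ZMod c) = a1 at *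
    generalize (x2 : ZMod c) = a2 at *
    generalize (x3 : ZMod c) = a3 at *
    generalize (x4 : ZMod c) = a4 at *
    have h3 : (a1 + a2) * (a3 * a4) = (a3 + a4) * (a1 * a2) := by
      have l : (z1 + z2) * (a1 * a2 * a3 * a4) = (a1 + a2) * (a3 * a4) := by
        linear_combination (a2 * a3 * a4) * e1 + (a1 * a3 * a4) * e2
      have r : (z3 + z4) * (a1 * a2 * a3 * a4) = (a3 + a4) * (a1 * a2) := by
        linear_combination (a1 * a2 * a4) * e3 + (a1 * a2 * a3) * e4
      rw [← l, ← r, h2]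
    have h4 : a4 = a1 + a2 - a3 := by rw [h1]; ring
    subst h4
    have h5 : (a1 + a2) * ((a3 - a1) * (a3 - a2)) = 0 := by linear_combination -h3
    linear_combination (z3 ^ 3) * h5 - (a1 + a2) * z3 * (
      (1 - a2 * z3) + (a3 * z3 - a1 * z3)) * e3
  · rintro ⟨⟨x1, x2⟩, ⟨x3, x4⟩⟩ h ⟨⟨x1', x2'⟩, ⟨x3', x4'⟩⟩ h' he
    simp only [Finset.coe_filter, Finset.mem_univ, true_and, Set.mem_ofPred_eq] at h h'
    simp only [Prod.mk.injEq] at he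
    obtain ⟨rfl, ha, hb⟩ := he
    have h1 : x1 = x1' := Units.ext ((Units.isUnit _).mul_right_cancel ha)
    have h2 : x2 = x2' := Units.ext ((Units.isUnit _).mul_right_cancel hb)
    subst h1 h2
    have h4 : x4 = x4' := Units.ext (add_left_cancel (h.1.symm.trans h'.1))
    rw [h4]

theorem card_filter_dvd_val {c d : ℕ} [NeZero c] (hd : d ∣ c) :
    (Finset.univ.filter fun x : ZMod c => d ∣ x.val).card ≤ c / d := by
  have hd0 : 0 < d := Nat.pos_of_dvd_of_pos hd (Nat.pos_of_ne_zero (NeZero.ne c))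
  rw [← Finset.card_range (c / d)]
  refine Finset.card_le_card_of_injOn (fun x => x.val / d) ?_ ?_
  · intro x hx
    simp only [Finset.coe_range, Set.mem_Iio]
    exact Nat.div_lt_div_of_lt_of_dvd hd x.val_lt
  · intro x hx y hy h
    simp only [Finset.coe_filter, Finset.mem_univ, true_and, Set.mem_ofPred_eq] at hx hy h
    exact ZMod.val_injective c ((Nat.div_left_inj hx hy).1 h)

theorem card_filter_mul_mul_eq_zero_le (c : ℕ) [NeZero c] :
    ((Finset.univ.filter fun y : ZMod c × ZMod c =>
        (y.1 + y.2) * ((1 - y.1) * (1 - y.2)) = 0).card : ℝ) ≤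
      3 * c.divisors.card * (c : ℝ) ^ (5 / 3 : ℝ) := by
  classical
  have hc : 0 < c := Nat.pos_of_ne_zero (NeZero.ne c)
  let E : ℕ → Finset (ZMod c) := fun d => Finset.univ.filter fun x : ZMod c => d ∣ x.val
  let D : Finset ℕ := c.divisors.filter fun d => c ≤ d ^ 3
  let T : ℕ → Finset (ZMod c × ZMod c) := fun d =>
    (Finset.univ.filter fun y : ZMod c × ZMod c => y.1 + y.2 ∈ E d) ∪
    (Finset.univ.filter fun y : ZMod c × ZMod c => 1 - y.1 ∈ E d) ∪
    (Finset.univ.filter fun y : ZMod c × ZMod c => 1 - y.2 ∈ E d)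
  have hsub : (Finset.univ.filter fun y : ZMod c × ZMod c =>
        (y.1 + y.2) * ((1 - y.1) * (1 - y.2)) = 0) ⊆ D.biUnion T := by
    rintro ⟨y1, y2⟩ hy
    simp only [Finset.mem_filter, Finset.mem_univ, true_and] at hy
    have hdvd : c ∣ (y1 + y2).val * ((1 - y1).val * (1 - y2).val) := by
      rw [← ZMod.natCast_eq_zero_iff]
      simpa using hy
    obtain ⟨d1, e, h1, he, rfl⟩ := exists_dvd_and_dvd_of_dvd_mul hdvd
    obtain ⟨d2, d3, h2, h3, rfl⟩ := exists_dvd_and_dvd_of_dvd_mul he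
    have hmem (d : ℕ) (hd : d ∣ d1 * (d2 * d3)) (hl : d1 ≤ d ∧ d2 ≤ d ∧ d3 ≤ d) : d ∈ D := by
      simp only [D, Finset.mem_filter, Nat.mem_divisors]
      refine ⟨⟨hd, hc.ne'⟩, ?_⟩
      calc d1 * (d2 * d3) ≤ d * (d * d) := by gcongr <;> tauto
        _ = d ^ 3 := by ring
    have hmax : (d2 ≤ d1 ∧ d3 ≤ d1) ∨ (d1 ≤ d2 ∧ d3 ≤ d2) ∨ (d1 ≤ d3 ∧ d2 ≤ d3) := by omega
    simp only [Finset.mem_biUnion, T, E, Finset.mem_union, Finset.mem_filter, Finset.mem_univ,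
      true_and]
    rcases hmax with h | h | h
    · exact ⟨d1, hmem d1 (dvd_mul_right _ _) (by omega), Or.inl (Or.inl h1)⟩
    · exact ⟨d2, hmem d2 ⟨d1 * d3, by ring⟩ (by omega), Or.inl (Or.inr h2)⟩
    · exact ⟨d3, hmem d3 ⟨d1 * d2, by ring⟩ (by omega), Or.inr h3⟩
  have hT (d : ℕ) (hd : d ∈ D) : ((T d).card : ℝ) ≤ 3 * (c : ℝ) ^ (5 / 3 : ℝ) := by
    simp only [D, Finset.mem_filter, Nat.mem_divisors] at hd
    have hE : (E d).card ≤ c / d := card_filter_dvd_val hd.1.1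
    have hcard (f : ZMod c × ZMod c → ZMod c × ZMod c) (hf : Function.Injective f) :
        (Finset.univ.filter fun y : ZMod c × ZMod c => (f y).1 ∈ E d).card ≤ c * (c / d) := by
      calc _ ≤ (E d ×ˢ (Finset.univ : Finset (ZMod c))).card := by
            refine Finset.card_le_card_of_injOn f ?_ hf.injOn
            intro y hy
            simpa using hy
        _ = (E d).card * c := by rw [Finset.card_product, Finset.card_univ, ZMod.card]
        _ ≤ c * (c / d) := by rw [mul_comm]; gcongr
    have hTd : (T d).card ≤ 3 * (c * (c / d)) := by
      have i1 := hcard (fun y => (y.1 + y.2, y.2)) (fun x y h => by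
        simp only [Prod.mk.injEq] at h; obtain ⟨h, h'⟩ := h; ext
        · rw [h'] at h; exact add_right_cancel h
        · exact h')
      have i2 := hcard (fun y => (1 - y.1, y.2)) (fun x y h => by
        simp only [Prod.mk.injEq] at h; obtain ⟨h, h'⟩ := h; ext
        · exact sub_right_injective h
        · exact h')
      have i3 := hcard (fun y => (1 - y.2, y.1)) (fun x y h => by
        simp only [Prod.mk.injEq] at h; obtain ⟨h, h'⟩ := h; ext
        · exact h'
        · exact sub_right_injective h)
      have := Finset.card_union_le ((Finset.univ.filter fun y : ZMod c × ZMod c => y.1 + y.2 ∈ E d) ∪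
        (Finset.univ.filter fun y : ZMod c × ZMod c => 1 - y.1 ∈ E d))
        (Finset.univ.filter fun y : ZMod c × ZMod c => 1 - y.2 ∈ E d)
      have := Finset.card_union_le (Finset.univ.filter fun y : ZMod c × ZMod c => y.1 + y.2 ∈ E d)
        (Finset.univ.filter fun y : ZMod c × ZMod c => 1 - y.1 ∈ E d)
      simp only [T] at *
      omega
    have hd0 : 0 < d := Nat.pos_of_dvd_of_pos hd.1.1 hc
    have hdr : (c : ℝ) ^ (1 / 3 : ℝ) ≤ d := by
      have h3 : (c : ℝ) ≤ (d : ℝ) ^ 3 := by exact_mod_cast hd.2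
      calc (c : ℝ) ^ (1 / 3 : ℝ) ≤ ((d : ℝ) ^ 3) ^ (1 / 3 : ℝ) := by gcongr
        _ = d := by
          rw [← Real.rpow_natCast, ← Real.rpow_mul (by positivity)]; norm_num
    calc ((T d).card : ℝ) ≤ 3 * ((c : ℝ) * ((c / d : ℕ) : ℝ)) := by exact_mod_cast hTd
      _ ≤ 3 * ((c : ℝ) * (c / d)) := by gcongr; exact Nat.cast_div_le
      _ ≤ 3 * ((c : ℝ) * (c / (c : ℝ) ^ (1 / 3 : ℝ))) := by gcongr
      _ = _ := by
        have hcr : (0 : ℝ) < c := by exact_mod_cast hc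
        rw [show (5 / 3 : ℝ) = 1 + 1 - 1 / 3 by norm_num, Real.rpow_sub hcr, Real.rpow_add hcr,
          Real.rpow_one]
        ring
  calc _ ≤ ((D.biUnion T).card : ℝ) := by exact_mod_cast Finset.card_le_card hsub
    _ ≤ ∑ d ∈ D, ((T d).card : ℝ) := by exact_mod_cast Finset.card_biUnion_le
    _ ≤ ∑ d ∈ D, 3 * (c : ℝ) ^ (5 / 3 : ℝ) := Finset.sum_le_sum hT
    _ = D.card * (3 * (c : ℝ) ^ (5 / 3 : ℝ)) := by rw [Finset.sum_const, nsmul_eq_mul]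
    _ ≤ c.divisors.card * (3 * (c : ℝ) ^ (5 / 3 : ℝ)) := by
        gcongr; exact Finset.filter_subset _ _
    _ = _ := by ring

theorem sawtooth_intCast_div {c : ℕ} (hc : 0 < c) {n : ℤ} (hn : ¬ (c : ℤ) ∣ n) :
    sawtooth ((n : ℝ) / c) = ((n % c : ℤ) : ℝ) / c - 1 / 2 := by
  have hcr : (c : ℝ) ≠ 0 := by positivity
  have hfl : ⌊(n : ℝ) / c⌋ = n / (c : ℤ) := by
    have := Int.floor_div_natCast (n : ℝ) c
    simpa using this
  have hmod : (n : ℝ) = c * ((n / (c : ℤ) : ℤ) : ℝ) + ((n % c : ℤ) : ℝ) := by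
    exact_mod_cast (Int.mul_ediv_add_emod n c).symm
  have hne : ((n % c : ℤ) : ℝ) ≠ 0 := by
    exact_mod_cast fun h => hn (Int.dvd_of_emod_eq_zero h)
  have hdiv : (n : ℝ) / c = ((n / (c : ℤ) : ℤ) : ℝ) + ((n % c : ℤ) : ℝ) / c := by
    rw [hmod]; field_simp
  rw [sawtooth, hfl, if_neg]
  · rw [hdiv]; ring
  · rw [hdiv]
    intro h
    exact div_ne_zero hne hcr (by linarith)

theorem sum_range_mul_mod {M : Type*} [AddCommMonoid M] {c d : ℕ} [NeZero c] (hd : d.Coprime c)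
    (f : ℕ → M) : ∑ k ∈ Finset.range c, f (k * d % c) = ∑ k ∈ Finset.range c, f k := by
  have key : Set.InjOn (fun k => k * d % c) (Finset.range c) := by
    intro k hk l hl h
    have h1 : k ≡ l [MOD c] := Nat.ModEq.cancel_right_of_coprime (by rwa [Nat.gcd_comm]) h
    have hk' : k < c := by simpa using hk
    have hl' : l < c := by simpa using hl
    rwa [Nat.ModEq, Nat.mod_eq_of_lt hk', Nat.mod_eq_of_lt hl'] at h1
  have himg : (Finset.range c).image (fun k => k * d % c) = Finset.range c := by
    refine Finset.eq_of_subset_of_card_le ?_ (by rw [Finset.card_image_of_injOn key])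
    intro x hx
    obtain ⟨k, -, rfl⟩ := Finset.mem_image.1 hx
    exact Finset.mem_range.2 (Nat.mod_lt _ (Nat.pos_of_ne_zero (NeZero.ne c)))
  conv_rhs => rw [← himg]
  rw [Finset.sum_image key]

theorem twelve_mul_dedekindSum {c d : ℕ} [NeZero c] (hd : d.Coprime c) :
    12 * dedekindSum d c =
      12 * ((∑ k ∈ Finset.range c, k * (k * d % c) : ℕ) : ℝ) / (c : ℝ) ^ 2 - 3 * (c - 1) := by
  have hc : 0 < c := Nat.pos_of_ne_zero (NeZero.ne c)
  have hcr : (c : ℝ) ≠ 0 := by positivity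
  have hterm : ∀ k ∈ Finset.Ico 1 c, sawtooth ((k : ℝ) / c) * sawtooth ((k : ℝ) * (d : ℤ) / c) =
      ((k : ℝ) / c - 1 / 2) * (((k * d % c : ℕ) : ℝ) / c - 1 / 2) := by
    intro k hk
    obtain ⟨hk1, hk2⟩ := Finset.mem_Ico.1 hk
    have hnk : ¬ c ∣ k := Nat.not_dvd_of_pos_of_lt hk1 hk2
    have e1 := sawtooth_intCast_div hc (n := (k : ℤ)) (by exact_mod_cast hnk)
    have e2 := sawtooth_intCast_div hc (n := ((k * d : ℕ) : ℤ))
      (by exact_mod_cast fun h => hnk (hd.symm.dvd_of_dvd_mul_right h))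
    rw [← Int.natCast_mod] at e1 e2
    rw [Nat.mod_eq_of_lt hk2] at e1
    simp only [Int.cast_natCast] at e1 e2 ⊢
    rw [e1, ← Nat.cast_mul, e2]
  have hzero : ∑ k ∈ Finset.Ico 1 c, ((k : ℝ) / c - 1 / 2) * (((k * d % c : ℕ) : ℝ) / c - 1 / 2) =
      ∑ k ∈ Finset.range c, ((k : ℝ) / c - 1 / 2) * (((k * d % c : ℕ) : ℝ) / c - 1 / 2) - 1 / 4 := by
    rw [Finset.range_eq_Ico, Finset.sum_eq_sum_Ico_succ_bot hc]
    simp only [Nat.cast_zero, zero_div, zero_mul, Nat.zero_mod, zero_add]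
    ring
  have hs1 : ∑ k ∈ Finset.range c, (k : ℝ) = c * (c - 1) / 2 := by
    have := Finset.sum_range_id_mul_two c
    have h2 : ((∑ k ∈ Finset.range c, k : ℕ) : ℝ) * 2 = c * ((c - 1 : ℕ) : ℝ) := by
      exact_mod_cast this
    rw [Nat.cast_sub hc] at h2
    push_cast at h2
    linarith
  have hs2 : ∑ k ∈ Finset.range c, ((k * d % c : ℕ) : ℝ) = c * (c - 1) / 2 := by
    rw [sum_range_mul_mod hd (fun k => (k : ℝ)), hs1]
  have hexp : ∑ k ∈ Finset.range c, ((k : ℝ) / c - 1 / 2) * (((k * d % c : ℕ) : ℝ) / c - 1 / 2) =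
      (∑ k ∈ Finset.range c, (k : ℝ) * ((k * d % c : ℕ) : ℝ)) / (c : ℝ) ^ 2
        - (∑ k ∈ Finset.range c, (k : ℝ)) / (2 * c)
        - (∑ k ∈ Finset.range c, ((k * d % c : ℕ) : ℝ)) / (2 * c) + c / 4 := by
    rw [Finset.sum_div, Finset.sum_div, Finset.sum_div, ← Finset.sum_sub_distrib,
      ← Finset.sum_sub_distrib]
    have : (c : ℝ) / 4 = ∑ k ∈ Finset.range c, (1 / 4 : ℝ) := by
      rw [Finset.sum_const, Finset.card_range, nsmul_eq_mul]; ring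
    rw [this, ← Finset.sum_add_distrib]
    refine Finset.sum_congr rfl fun k _ => ?_
    field_simp
    ring
  rw [dedekindSum, Finset.sum_congr rfl hterm, hzero, hexp, hs1, hs2]
  push_cast
  field_simp
  ring

/-- Modulo `c ^ 2`, the sum `∑ k (k d mod c)` is determined by `d`. -/
theorem twelve_mul_sum_mul_mod_modEq {c d : ℕ} [NeZero c] (hd : d.Coprime c) :
    (c : ℤ) ^ 2 ∣ 12 * d * (∑ k ∈ Finset.range c, k * (k * d % c) : ℕ) - c * (1 + d ^ 2) := by
  have hsq : (c : ℤ) ^ 2 ∣ ∑ k ∈ Finset.range c, (((k * d % c : ℕ) : ℤ) - k * d) ^ 2 := by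
    refine Finset.dvd_sum fun k _ => pow_dvd_pow_of_dvd ?_ 2
    rw [← Int.modEq_iff_dvd]
    push_cast
    exact (Int.mod_modEq _ _).symm
  have hs6 : 6 * ∑ k ∈ Finset.range c, (k : ℤ) ^ 2 = c * (c - 1) * (2 * c - 1) := by
    generalize c = n
    induction n with
    | zero => simp
    | succ n ih => rw [Finset.sum_range_succ, mul_add, ih]; push_cast; ring
  have hr : ∑ k ∈ Finset.range c, ((k * d % c : ℕ) : ℤ) ^ 2 = ∑ k ∈ Finset.range c, (k : ℤ) ^ 2 :=
    sum_range_mul_mod hd (fun k => (k : ℤ) ^ 2)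
  have hexp : ∑ k ∈ Finset.range c, (((k * d % c : ℕ) : ℤ) - k * d) ^ 2 =
      (1 + (d : ℤ) ^ 2) * ∑ k ∈ Finset.range c, (k : ℤ) ^ 2
        - 2 * d * ∑ k ∈ Finset.range c, (k : ℤ) * ((k * d % c : ℕ) : ℤ) := by
    rw [add_mul, one_mul, ← hr, hr, Finset.mul_sum, Finset.mul_sum, ← hr,
      ← Finset.sum_add_distrib, ← Finset.sum_sub_distrib]
    exact Finset.sum_congr rfl fun k _ => by ring
  obtain ⟨w, hw⟩ := hsq
  rw [hexp] at hw
  refine ⟨(1 + (d : ℤ) ^ 2) * (2 * c - 3) - 6 * w, ?_⟩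
  push_cast
  push_cast at hw
  linear_combination (1 + (d : ℤ) ^ 2) * hs6 - 6 * hw

theorem exists_twelve_mul_dedekindSum {c d : ℕ} [NeZero c] (hd : d.Coprime c) :
    ∃ U n : ℤ, 12 * dedekindSum d c = (U : ℝ) / c + n ∧
      (U : ZMod c) = d + ((ZMod.unitOfCoprime d hd)⁻¹ : (ZMod c)ˣ) := by
  have hc : 0 < c := Nat.pos_of_ne_zero (NeZero.ne c)
  have hcr : (c : ℝ) ≠ 0 := by positivity
  have hcz : (c : ℤ) ≠ 0 := by exact_mod_cast hc.ne'
  obtain ⟨T, hT⟩ : ∃ T : ℤ, ((∑ k ∈ Finset.range c, k * (k * d % c) : ℕ) : ℤ) = T := ⟨_, rfl⟩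
  have hdvd := twelve_mul_sum_mul_mod_modEq hd
  rw [hT] at hdvd
  have h1 : (c : ℤ) ∣ d * (12 * T) := by
    have h2 := (Dvd.intro_left (c : ℤ) (by ring : (c : ℤ) * c = (c : ℤ) ^ 2)).trans hdvd
    have := dvd_add h2 (dvd_mul_right (c : ℤ) (1 + (d : ℤ) ^ 2))
    rw [sub_add_cancel] at this
    rwa [mul_comm (12 : ℤ), mul_assoc] at this
  obtain ⟨U, hU⟩ := (Nat.Coprime.isCoprime hd).symm.dvd_of_dvd_mul_left h1
  refine ⟨U, -3 * (c - 1), ?_, ?_⟩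
  · have hUr : 12 * ((∑ k ∈ Finset.range c, k * (k * d % c) : ℕ) : ℝ) = c * U := by
      have h2 := congrArg (Int.cast : ℤ → ℝ) hU
      rw [← hT] at h2
      push_cast at h2 ⊢
      exact h2
    rw [twelve_mul_dedekindSum hd, hUr]
    push_cast
    field_simp
    ring
  · have h3 : (c : ℤ) ∣ d * U - (1 + d ^ 2) := by
      refine (mul_dvd_mul_iff_left hcz).1 ?_
      have h4 : (c : ℤ) * (d * U - (1 + d ^ 2)) = 12 * d * T - c * (1 + d ^ 2) := by
        linear_combination -(d : ℤ) * hU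
      rwa [h4, ← sq]
    have h4 : (d : ZMod c) * U = 1 + (d : ZMod c) ^ 2 := by
      have := (ZMod.intCast_zmod_eq_zero_iff_dvd _ c).2 h3
      push_cast at this
      exact sub_eq_zero.1 this
    have h5 : (d : ZMod c) * ((ZMod.unitOfCoprime d hd)⁻¹ : (ZMod c)ˣ) = 1 := by
      have := (ZMod.unitOfCoprime d hd).mul_inv
      rwa [ZMod.coe_unitOfCoprime] at this
    linear_combination ((ZMod.unitOfCoprime d hd)⁻¹ : (ZMod c)ˣ) * h4 - (U - d) * h5

theorem norm_kloostermanSum_div_totient_pow_four_le {m : ℤ} (hm : m ≠ 0) :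
    ∃ C : ℝ, ∀ (c : ℕ) [NeZero c],
      (‖kloostermanSum (m : ZMod c) m‖ / c.totient) ^ 4 ≤ C * (c : ℝ) ^ (-(1 / 6) : ℝ) := by
  obtain ⟨C, hC0, hC⟩ := exists_card_divisors_le_rpow (ε := 1 / 30) (by norm_num)
  refine ⟨3 * m.natAbs * C ^ 5, fun c _ => ?_⟩
  have hc : 0 < c := Nat.pos_of_ne_zero (NeZero.ne c)
  have hcr : (0 : ℝ) < c := by exact_mod_cast hc
  have hφ : (0 : ℝ) < c.totient := by exact_mod_cast Nat.totient_pos.2 hc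
  set K : ℝ := ‖kloostermanSum (m : ZMod c) m‖ with hK
  set τ : ℝ := (c.divisors.card : ℝ) with hτ
  have hτ1 : τ ≤ C * (c : ℝ) ^ (1 / 30 : ℝ) := hC c hc.ne'
  have hτφ : (c : ℝ) ≤ τ * c.totient := by
    rw [hτ]
    exact_mod_cast le_card_divisors_mul_totient c
  have h1 : K ^ 4 ≤ m.natAbs * ((c : ℝ) ^ 2 * (3 * τ * (c : ℝ) ^ (5 / 3 : ℝ))) := by
    refine le_of_mul_le_mul_left ?_ hφ
    have h2 := totient_mul_norm_kloostermanSum_pow_four_le (c := c) hm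
    rw [sum_sum_norm_kloostermanSum_pow_four] at h2
    have h3 : ((Finset.univ.filter fun p : ((ZMod c)ˣ × (ZMod c)ˣ) × ((ZMod c)ˣ × (ZMod c)ˣ) =>
        (p.1.1 : ZMod c) + p.1.2 = p.2.1 + p.2.2 ∧
        ((p.1.1⁻¹ : (ZMod c)ˣ) : ZMod c) + ((p.1.2⁻¹ : (ZMod c)ˣ) : ZMod c) =
          ((p.2.1⁻¹ : (ZMod c)ˣ) : ZMod c) + ((p.2.2⁻¹ : (ZMod c)ˣ) : ZMod c)).card : ℝ) ≤
        c.totient * (3 * τ * (c : ℝ) ^ (5 / 3 : ℝ)) := by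
      refine le_trans (Nat.cast_le.2 card_kloosterman_quadruples_le) ?_
      rw [Nat.cast_mul]
      gcongr
      exact card_filter_mul_mul_eq_zero_le c
    refine h2.trans ?_
    calc _ ≤ (m.natAbs : ℝ) * ((c : ℝ) ^ 2 * (c.totient * (3 * τ * (c : ℝ) ^ (5 / 3 : ℝ)))) := by
          gcongr
      _ = _ := by ring
  have h4 : (K / c.totient) ^ 4 ≤ (K * τ / c) ^ 4 := by
    refine pow_le_pow_left₀ (by positivity) ?_ 4
    rw [div_le_div_iff₀ hφ hcr, mul_assoc]
    gcongr
  calc (K / c.totient) ^ 4 ≤ (K * τ / c) ^ 4 := h4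
    _ = K ^ 4 * τ ^ 4 / (c : ℝ) ^ 4 := by rw [div_pow, mul_pow]
    _ ≤ m.natAbs * ((c : ℝ) ^ 2 * (3 * τ * (c : ℝ) ^ (5 / 3 : ℝ))) * τ ^ 4 / (c : ℝ) ^ 4 := by
        gcongr
    _ = 3 * m.natAbs * τ ^ 5 * ((c : ℝ) ^ (5 / 3 : ℝ) / (c : ℝ) ^ 2) := by
        field_simp
    _ ≤ 3 * m.natAbs * (C * (c : ℝ) ^ (1 / 30 : ℝ)) ^ 5 *
          ((c : ℝ) ^ (5 / 3 : ℝ) / (c : ℝ) ^ 2) := by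
        gcongr
    _ = 3 * m.natAbs * C ^ 5 * (c : ℝ) ^ (-(1 / 6) : ℝ) := by
        have h5 : ((c : ℝ) ^ (1 / 30 : ℝ)) ^ 5 = (c : ℝ) ^ (1 / 6 : ℝ) := by
          rw [← Real.rpow_natCast, ← Real.rpow_mul hcr.le]; norm_num
        have h6 : (c : ℝ) ^ (-(1 / 6) : ℝ) =
            (c : ℝ) ^ (1 / 6 : ℝ) * ((c : ℝ) ^ (5 / 3 : ℝ) / (c : ℝ) ^ 2) := by
          rw [← Real.rpow_natCast (c : ℝ) 2, ← Real.rpow_sub hcr, ← Real.rpow_add hcr]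
          norm_num
        rw [mul_pow, h5, h6]
        ring

theorem tendsto_norm_kloostermanSum_div_totient {m : ℤ} (hm : m ≠ 0) :
    Tendsto (fun n : ℕ => ‖kloostermanSum (m : ZMod (n + 1)) m‖ / (n + 1).totient)
      atTop (𝓝 0) := by
  obtain ⟨C, hC⟩ := norm_kloostermanSum_div_totient_pow_four_le hm
  have h1 : Tendsto (fun n : ℕ => (((n + 1 : ℕ) : ℝ)) ^ (-(1 / 6) : ℝ)) atTop (𝓝 0) :=
    (tendsto_rpow_neg_atTop (by norm_num)).comp
      (tendsto_natCast_atTop_atTop.comp (tendsto_add_atTop_nat 1))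
  have h2 : Tendsto (fun n : ℕ =>
      (‖kloostermanSum (m : ZMod (n + 1)) m‖ / (n + 1).totient) ^ 4) atTop (𝓝 0) :=
    squeeze_zero (fun n => by positivity) (fun n => hC (n + 1)) (by simpa using h1.const_mul C)
  have h3 := h2.rpow_const (p := 1 / 4) (Or.inr (by norm_num))
  rw [Real.zero_rpow (by norm_num)] at h3
  refine h3.congr fun n => ?_
  rw [← Real.rpow_natCast, ← Real.rpow_mul (by positivity)]
  norm_num

theorem sum_filter_coprime_eq_sum_units {M : Type*} [AddCommMonoid M] {c : ℕ} [NeZero c]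
    (g : ℕ → M) (f : (ZMod c)ˣ → M)
    (hgf : ∀ (d : ℕ) (hd : d.Coprime c), g d = f (ZMod.unitOfCoprime d hd)) :
    ∑ d ∈ (Finset.Icc 1 c).filter (fun d => Nat.Coprime d c), g d = ∑ u, f u := by
  refine Finset.sum_bij (fun d hd => ZMod.unitOfCoprime d (Finset.mem_filter.1 hd).2)
    (fun d hd => Finset.mem_univ _) ?_ ?_ (fun d hd => hgf d _)
  · intro d hd d' hd' h
    have h1 : (d : ZMod c) = d' := by
      have := congrArg (Units.val) h
      simpa only [ZMod.coe_unitOfCoprime] using this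
    simp only [Finset.mem_filter, Finset.mem_Icc] at hd hd'
    have h2 : (c : ℤ) ∣ d' - d := (Nat.modEq_iff_dvd).1 ((ZMod.natCast_eq_natCast_iff _ _ _).1 h1)
    have h3 : (d' : ℤ) - d = 0 := by
      refine Int.eq_zero_of_abs_lt_dvd h2 ?_
      rw [abs_lt]
      omega
    omega
  · intro u _
    have h1 : ((((u : ZMod c) - 1).val + 1 : ℕ) : ZMod c) = u := by simp
    have h2 : Nat.Coprime (((u : ZMod c) - 1).val + 1) c := by
      rw [← ZMod.isUnit_iff_coprime, h1]
      exact u.isUnit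
    refine ⟨((u : ZMod c) - 1).val + 1, ?_, ?_⟩
    · simp only [Finset.mem_filter, Finset.mem_Icc]
      exact ⟨⟨by omega, ZMod.val_lt _⟩, h2⟩
    · ext
      rw [ZMod.coe_unitOfCoprime, h1]

theorem card_filter_coprime_Icc (c : ℕ) [NeZero c] :
    ((Finset.Icc 1 c).filter (fun d => Nat.Coprime d c)).card = c.totient := by
  rw [Finset.card_eq_sum_ones, sum_filter_coprime_eq_sum_units (fun _ => 1) (fun _ => 1)
    (fun _ _ => rfl), ← Finset.card_eq_sum_ones, Finset.card_univ, ZMod.card_units_eq_totient]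

theorem fourier_twelve_mul_dedekindSum {c d : ℕ} [NeZero c] (hd : d.Coprime c) (m : ℤ) :
    fourier m ((12 * dedekindSum d c : ℝ) : UnitAddCircle) =
      ZMod.stdAddChar ((m : ZMod c) * (ZMod.unitOfCoprime d hd : ZMod c) +
        (m : ZMod c) * (((ZMod.unitOfCoprime d hd)⁻¹ : (ZMod c)ˣ) : ZMod c)) := by
  obtain ⟨U, n, h1, h2⟩ := exists_twelve_mul_dedekindSum hd
  rw [ZMod.coe_unitOfCoprime, ← mul_add, ← h2, ← Int.cast_mul, ZMod.stdAddChar_coe,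
    fourier_coe_apply, h1]
  rw [Complex.exp_eq_exp_iff_exists_int]
  refine ⟨m * n, ?_⟩
  push_cast
  ring

theorem sum_fourier_twelve_mul_dedekindSum (c : ℕ) [NeZero c] (m : ℤ) :
    ∑ d ∈ (Finset.Icc 1 c).filter (fun d => Nat.Coprime d c),
      fourier m ((12 * dedekindSum d c : ℝ) : UnitAddCircle) = kloostermanSum (m : ZMod c) m :=
  sum_filter_coprime_eq_sum_units _ _ fun _ hd => fourier_twelve_mul_dedekindSum hd m

/-- For each single large modulus `c` the fractional parts of `12 s(d,c)` are equidistributed. -/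
theorem tendsto_card_dedekindSum_div_card {α β : ℝ} (h0 : 0 ≤ α) (hαβ : α ≤ β) (h1 : β ≤ 1) :
    Tendsto (fun c : ℕ => (((Finset.Icc 1 c).filter (fun d => Nat.Coprime d c ∧
      α ≤ Int.fract (12 * dedekindSum (d : ℤ) c) ∧
      Int.fract (12 * dedekindSum (d : ℤ) c) < β)).card : ℝ) /
      ((Finset.Icc 1 c).filter (fun d => Nat.Coprime d c)).card) atTop (𝓝 (β - α)) := by
  rw [← tendsto_add_atTop_iff_nat 1]
  have key := tendsto_card_filter_fract_div_card
    (fun n => (Finset.Icc 1 (n + 1)).filter (fun d => Nat.Coprime d (n + 1)))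
    (fun n d => 12 * dedekindSum (d : ℤ) (n + 1)) (fun n => ⟨1, by simp⟩) (fun m hm => by
      rw [tendsto_zero_iff_norm_tendsto_zero]
      refine (tendsto_norm_kloostermanSum_div_totient hm).congr fun n => ?_
      rw [sum_fourier_twelve_mul_dedekindSum, card_filter_coprime_Icc, norm_div,
        Complex.norm_natCast]) h0 hαβ h1
  refine key.congr fun n => ?_
  rw [Finset.filter_filter]

theorem tendsto_dedekindTotal {q : ℕ} (hq : 0 < q) (a : ℤ) :
    Tendsto (fun x => (dedekindTotal q a x : ℝ)) atTop atTop := by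
  refine tendsto_natCast_atTop_atTop.comp ?_
  have hmono : Monotone (dedekindTotal q a) := fun x y hxy =>
    Finset.sum_le_sum_of_subset (Finset.Icc_subset_Icc_right hxy)
  refine tendsto_atTop_atTop_of_monotone hmono fun b => ?_
  have hqz : (0 : ℤ) < q := by exact_mod_cast hq
  let r : ℕ := (a % q).toNat
  have hr : (r : ℤ) = a % q := Int.toNat_of_nonneg (Int.emod_nonneg _ hqz.ne')
  refine ⟨r + q * b, ?_⟩
  calc b = ∑ j ∈ Finset.Icc 1 b, 1 := by simp
    _ = ∑ c ∈ (Finset.Icc 1 b).image (fun j => r + q * j), 1 := by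
        rw [Finset.sum_image]
        intro i _ j _ h
        exact Nat.eq_of_mul_eq_mul_left hq (Nat.add_left_cancel h)
    _ ≤ ∑ c ∈ (Finset.Icc 1 b).image (fun j => r + q * j), (if (c : ℤ) % (q : ℤ) = a % (q : ℤ) then
          ((Finset.Icc 1 c).filter (fun d => Nat.Coprime d c)).card else 0) := by
        refine Finset.sum_le_sum fun c hc => ?_
        obtain ⟨j, hj, rfl⟩ := Finset.mem_image.1 hc
        have hj1 := (Finset.mem_Icc.1 hj).1
        have hpos : 1 ≤ q * j := Nat.mul_pos hq hj1
        rw [if_pos (by push_cast; rw [Int.add_mul_emod_self_left, hr, Int.emod_emod])]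
        refine Finset.card_pos.2 ⟨1, ?_⟩
        simp only [Finset.mem_filter, Finset.mem_Icc, Nat.coprime_one_left_iff, and_true]
        omega
    _ ≤ dedekindTotal q a (r + q * b) := by
        refine Finset.sum_le_sum_of_subset fun c hc => ?_
        obtain ⟨j, hj, rfl⟩ := Finset.mem_image.1 hc
        obtain ⟨hj1, hj2⟩ := Finset.mem_Icc.1 hj
        have hpos : 1 ≤ q * j := Nat.mul_pos hq hj1
        have hle : q * j ≤ q * b := Nat.mul_le_mul_left q hj2
        rw [Finset.mem_Icc]
        omega

/-- Equidistribution of `⟨12 s(d,c)⟩` over `c ≡ a (mod q)`, `(a,q) = 1`: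
for `0 ≤ α < β ≤ 1`, the proportion of pairs `(c,d)` with `c ≤ x`, `c ≡ a (mod q)`,
`d mod c` primitive and `α ≤ ⟨12 s(d,c)⟩ < β` tends to `β - α` as `x → ∞`. -/
theorem dedekind_sums_equidistributed
    (q : ℕ) (hq : 0 < q) (a : ℤ) (ha : Int.gcd a q = 1)
    (α β : ℝ) (h0 : 0 ≤ α) (hαβ : α < β) (h1 : β ≤ 1) :
    Filter.Tendsto
      (fun x : ℕ => (dedekindCount q a α β x : ℝ) / (dedekindTotal q a x : ℝ))
      Filter.atTop (nhds (β - α)) := by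
  have hcast (p : ℕ → Prop) [DecidablePred p] (F : ℕ → ℕ) (x : ℕ) :
      ((∑ c ∈ Finset.Icc 1 x, if p c then F c else 0 : ℕ) : ℝ) =
        ∑ c ∈ Finset.Icc 1 x, if p c then (F c : ℝ) else 0 := by
    push_cast
    rfl
  have htot := tendsto_dedekindTotal hq a
  simp only [dedekindTotal, dedekindCount, hcast] at htot ⊢
  refine tendsto_sum_div_sum_of_tendsto_div ?_ htot
    (tendsto_card_dedekindSum_div_card h0 hαβ.le h1)
  intro n hn _
  exact Nat.cast_pos.2 (Finset.card_pos.2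
    ⟨1, Finset.mem_filter.2 ⟨Finset.mem_Icc.2 ⟨le_rfl, hn⟩, Nat.coprime_one_left n⟩⟩)
end

section
/- Let m, n, q be positive integers, X > 0, let f : (ℤ/qℤ)^× → ℂ, and let f_∞ : (0,∞) → ℂ be a smooth, compactly supported function. For each Dirichlet character χ modulo q, let χ₁ modulo q₁ denote the primitive character inducing χ. Then Σ_{c ≥ 1, gcd(c,q)=1} S(m,n,c) c^{-1/2} f(c) f_∞(c/X) = φ(q)^{-1/2} Σ_{χ mod q} (χ(m') f̂(χ)/τ(χ₁)) · Σ_{d | q} μ(d) Σ_{c ≥ 1, dq₁ | c} (q₁^{1/2}/c^{1/2}) S_{χ₁}(m', n'q₁², c) f_∞(c/(q₁X)). -/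
open scoped BigOperators

/-- `e(x) = exp(2πix)`. -/
noncomputable def e2 (x : ℝ) : ℂ := Complex.exp (2 * Real.pi * Complex.I * x)

/-- The Kloosterman sum `S(m,n,c)`. -/
noncomputable def klSum (m n : ℤ) (c : ℕ) : ℂ :=
  ∑ d ∈ (Finset.range c).filter (fun d => Nat.Coprime d c),
    e2 (((m * d + n * (((d : ZMod c)⁻¹).val : ℤ) : ℤ) : ℝ) / c)

/-- The twisted Kloosterman sum `S_χ(m,n,c)` for a Dirichlet character `χ` mod `q₁`. -/
noncomputable def klSumTwist {q₁ : ℕ} (χ : DirichletCharacter ℂ q₁) (m n : ℤ) (c : ℕ) : ℂ :=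
  ∑ d ∈ (Finset.range c).filter (fun d => Nat.Coprime d c),
    χ (d : ZMod q₁) * e2 (((m * d + n * (((d : ZMod c)⁻¹).val : ℤ) : ℤ) : ℝ) / c)

/-- The Gauss sum `τ(χ) = Σ_{a mod q₁} χ(a) e(a/q₁)`. -/
noncomputable def gaussS {q₁ : ℕ} (χ : DirichletCharacter ℂ q₁) : ℂ :=
  ∑ a ∈ Finset.range q₁, χ (a : ZMod q₁) * e2 ((a : ℝ) / q₁)

/-- `(m, q^∞)`, the largest divisor of `m` all of whose prime factors divide `q`;
for `m ≥ 1` this equals `gcd(m, q^m)`. -/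
def qInfGcd (m q : ℕ) : ℕ := Nat.gcd m (q ^ m)

/-- The `q`-Mellin transform `f̂(χ) = φ(q)^{-1/2} Σ_{c ∈ (ℤ/qℤ)ˣ} conj(χ(c)) f(c)`. -/
noncomputable def qMellin (q : ℕ) [NeZero q] (f : (ZMod q)ˣ → ℂ)
    (χ : DirichletCharacter ℂ q) : ℂ :=
  ((q.totient : ℝ) ^ (-(1/2) : ℝ) : ℝ) * ∑ c : (ZMod q)ˣ, (starRingEnd ℂ) (χ c) * f c

lemma e2_intCast_div (c : ℕ) [NeZero c] (j : ℤ) :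
    e2 ((j : ℝ) / c) = ZMod.stdAddChar (j : ZMod c) := by
  rw [ZMod.stdAddChar_coe, e2]
  congr 1
  push_cast
  ring

lemma sum_coprime_eq_sum_units (c : ℕ) [NeZero c] (F : ZMod c → ℂ) :
    ∑ d ∈ (Finset.range c).filter (fun d => Nat.Coprime d c), F (d : ZMod c) =
      ∑ u : (ZMod c)ˣ, F u := by
  refine Finset.sum_bij' (fun d hd => ZMod.unitOfCoprime d (Finset.mem_filter.1 hd).2)
    (fun u _ => (u : ZMod c).val) (fun _ _ => Finset.mem_univ _) (fun u _ => ?_)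
    (fun d hd => ?_) (fun u _ => ?_) (fun d hd => ?_)
  · exact Finset.mem_filter.2 ⟨Finset.mem_range.2 (ZMod.val_lt _), ZMod.val_coe_unit_coprime u⟩
  · simpa using ZMod.val_cast_of_lt (Finset.mem_range.1 (Finset.mem_filter.1 hd).1)
  · ext
    simp
  · simp

lemma klSum_eq_sum_units (m n : ℤ) (c : ℕ) [NeZero c] :
    klSum m n c = ∑ u : (ZMod c)ˣ,
      ZMod.stdAddChar (N := c) ((m : ZMod c) * (u : ZMod c) + n * (u⁻¹ : (ZMod c)ˣ)) := by
  simp only [← ZMod.inv_coe_unit]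
  rw [← sum_coprime_eq_sum_units c fun x => ZMod.stdAddChar (N := c) ((m : ZMod c) * x + n * x⁻¹)]
  refine Finset.sum_congr rfl fun d _ => ?_
  rw [e2_intCast_div]
  simp

lemma klSumTwist_eq_sum_units {q₁ : ℕ} (χ : DirichletCharacter ℂ q₁) (m n : ℤ) (c : ℕ)
    [NeZero c] (h : q₁ ∣ c) :
    klSumTwist χ m n c = ∑ u : (ZMod c)ˣ, χ (ZMod.castHom h (ZMod q₁) u) *
      ZMod.stdAddChar (N := c) ((m : ZMod c) * (u : ZMod c) + n * (u⁻¹ : (ZMod c)ˣ)) := by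
  simp only [← ZMod.inv_coe_unit]
  rw [← sum_coprime_eq_sum_units c fun x => χ (ZMod.castHom h (ZMod q₁) x) *
    ZMod.stdAddChar (N := c) ((m : ZMod c) * x + n * x⁻¹)]
  refine Finset.sum_congr rfl fun d _ => ?_
  rw [e2_intCast_div]
  simp

lemma gaussS_eq_gaussSum {q₁ : ℕ} [NeZero q₁] (χ : DirichletCharacter ℂ q₁) :
    gaussS χ = gaussSum χ ZMod.stdAddChar := by
  refine Finset.sum_bij' (fun a _ => (a : ZMod q₁)) (fun x _ => x.val)
    (fun _ _ => Finset.mem_univ _) (fun x _ => Finset.mem_range.2 (ZMod.val_lt x))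
    (fun a ha => ZMod.val_cast_of_lt (Finset.mem_range.1 ha)) (fun x _ => by simp)
    (fun a _ => ?_)
  simpa using congrArg (χ (a : ZMod q₁) * ·) (e2_intCast_div q₁ a)

lemma gaussS_ne_zero {q₁ : ℕ} [NeZero q₁] {χ : DirichletCharacter ℂ q₁} (hχ : χ.IsPrimitive) :
    gaussS χ ≠ 0 := by
  rw [gaussS_eq_gaussSum]
  intro h
  have h0 : ZMod.dft (χ : ZMod q₁ → ℂ) = 0 := by
    ext k
    rw [hχ.fourierTransform_eq_inv_mul_gaussSum, h, mul_zero, Pi.zero_apply]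
  have h1 := congrFun ((LinearEquiv.map_eq_zero_iff _).1 h0) 1
  simp at h1

/-- Multiplying the first argument by a unit is the same as multiplying the second one. -/
lemma klSum_mul_comm (m n g : ℤ) (c : ℕ) [NeZero c] (hg : IsUnit (g : ZMod c)) :
    klSum (m * g) n c = klSum m (n * g) c := by
  rw [klSum_eq_sum_units, klSum_eq_sum_units]
  obtain ⟨v, hv⟩ := hg
  refine Fintype.sum_equiv (Equiv.mulRight v) _ _ fun u => ?_
  congr 1
  have h : (v : ZMod c) * ↑v⁻¹ = 1 := v.mul_inv
  push_cast
  rw [← hv, Equiv.coe_mulRight, mul_inv_rev]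
  push_cast
  linear_combination (-(n : ZMod c) * ↑u⁻¹) * h

lemma stdAddChar_intCast_mul {N a k : ℕ} [NeZero N] [NeZero a] (h : N = k * a) (j : ℤ) :
    ZMod.stdAddChar ((k * j : ℤ) : ZMod N) = ZMod.stdAddChar (j : ZMod a) := by
  rw [ZMod.stdAddChar_coe, ZMod.stdAddChar_coe]
  have hN : (N : ℂ) ≠ 0 := by exact_mod_cast NeZero.ne N
  subst h
  push_cast at hN ⊢
  have ha := right_ne_zero_of_mul hN
  have hk := left_ne_zero_of_mul hN
  congr 1
  field_simp

/-- Additive characters split along the Chinese remainder theorem. -/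
lemma stdAddChar_eq_mul_of_coprime {a b : ℕ} [NeZero a] [NeZero b] [NeZero (a * b)]
    (h : a.Coprime b) (t : ZMod (a * b)) :
    ZMod.stdAddChar t =
      ZMod.stdAddChar (N := a) ((b : ZMod a)⁻¹ * ZMod.castHom (dvd_mul_right a b) (ZMod a) t) *
      ZMod.stdAddChar (N := b) ((a : ZMod b)⁻¹ * ZMod.castHom (dvd_mul_left b a) (ZMod b) t) := by
  obtain ⟨t, rfl⟩ := ZMod.intCast_surjective t
  obtain ⟨x, y, hxy⟩ := Nat.isCoprime_iff_coprime.2 h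
  have hb : (b : ZMod a)⁻¹ = (y : ZMod a) := by
    refine ZMod.inv_eq_of_mul_eq_one _ _ _ ?_
    simpa [mul_comm] using congrArg (Int.cast : ℤ → ZMod a) hxy
  have ha : (a : ZMod b)⁻¹ = (x : ZMod b) := by
    refine ZMod.inv_eq_of_mul_eq_one _ _ _ ?_
    simpa [mul_comm] using congrArg (Int.cast : ℤ → ZMod b) hxy
  simp only [ha, hb, map_intCast, ← Int.cast_mul]
  rw [← stdAddChar_intCast_mul (mul_comm a b) (y * t),
    ← stdAddChar_intCast_mul (N := a * b) (k := a) rfl (x * t),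
    ← AddChar.map_add_eq_mul, ← Int.cast_add]
  congr 2
  linear_combination -t * hxy

lemma sum_units_mul_stdAddChar {a : ℕ} [NeZero a] {χ : DirichletCharacter ℂ a}
    (hχ : χ.IsPrimitive) (k : ZMod a) :
    ∑ u : (ZMod a)ˣ, χ u * ZMod.stdAddChar (N := a) (k * u) = χ⁻¹ k * gaussS χ := by
  rw [gaussS_eq_gaussSum, ← gaussSum_mulShift_of_isPrimitive _ hχ]
  refine Fintype.sum_of_injective _ Units.val_injective _ _ (fun x hx => ?_) fun u => ?_
  · rw [MulChar.map_nonunit _ hx, zero_mul]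
  · rw [AddChar.mulShift_apply]

/-- Twisted multiplicativity of Kloosterman sums with a primitive nebentypus. -/
lemma klSumTwist_mul_of_coprime {a b : ℕ} [NeZero a] [NeZero b] (h : a.Coprime b)
    {χ : DirichletCharacter ℂ a} (hχ : χ.IsPrimitive) (m n : ℤ) :
    klSumTwist χ m (n * (a : ℤ) ^ 2) (a * b) = χ b * χ⁻¹ m * gaussS χ * klSum m n b := by
  have : NeZero (a * b) := ⟨mul_ne_zero (NeZero.ne a) (NeZero.ne b)⟩
  let v : (ZMod b)ˣ := ZMod.unitOfCoprime a h
  let w : (ZMod a)ˣ := ZMod.unitOfCoprime b h.symm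
  have hv : (v : ZMod b) = a := ZMod.coe_unitOfCoprime a h
  have hw : (w : ZMod a) = b := ZMod.coe_unitOfCoprime b h.symm
  let e : (ZMod (a * b))ˣ ≃* (ZMod a)ˣ × (ZMod b)ˣ :=
    (Units.mapEquiv (ZMod.chineseRemainder h).toMulEquiv).trans .prodUnits
  have he1 (u) : ((e u).1 : ZMod a) = ZMod.castHom (dvd_mul_right a b) (ZMod a) u := by
    exact DFunLike.congr_fun (Subsingleton.elim ((RingHom.fst (ZMod a) (ZMod b)).comp
      (ZMod.chineseRemainder h : ZMod (a * b) →+* ZMod a × ZMod b)) _) (u : ZMod (a * b))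
  have he2 (u) : ((e u).2 : ZMod b) = ZMod.castHom (dvd_mul_left b a) (ZMod b) u := by
    exact DFunLike.congr_fun (Subsingleton.elim ((RingHom.snd (ZMod a) (ZMod b)).comp
      (ZMod.chineseRemainder h : ZMod (a * b) →+* ZMod a × ZMod b)) _) (u : ZMod (a * b))
  rw [klSumTwist_eq_sum_units χ _ _ _ (dvd_mul_right a b)]
  trans ∑ p : (ZMod a)ˣ × (ZMod b)ˣ,
      (χ p.1 * ZMod.stdAddChar (N := a) ((b : ZMod a)⁻¹ * m * p.1)) *
        ZMod.stdAddChar (N := b) ((m : ZMod b) * (v⁻¹ * p.2 : (ZMod b)ˣ) +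
          n * ((v⁻¹ * p.2)⁻¹ : (ZMod b)ˣ))
  · refine Fintype.sum_equiv e.toEquiv _ _ fun u => ?_
    have hi2 : ZMod.castHom (dvd_mul_left b a) (ZMod b) ((u⁻¹ : (ZMod (a * b))ˣ) : ZMod (a * b)) =
        ((e u).2⁻¹ : (ZMod b)ˣ) := by
      rw [← he2, map_inv, Prod.snd_inv]
    rw [stdAddChar_eq_mul_of_coprime h, mul_assoc]
    simp only [map_add, map_mul, hi2, ← he1, ← he2, map_intCast, MulEquiv.toEquiv_eq_coe,
      EquivLike.coe_coe, mul_inv_rev, inv_inv]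
    congr 3
    · push_cast
      simp
      ring
    · rw [← hv, ZMod.inv_coe_unit]
      have hvv : (v : ZMod b) * ↑v⁻¹ = 1 := v.mul_inv
      push_cast
      rw [← hv]
      linear_combination (n * ↑((e u).2⁻¹) * v : ZMod b) * hvv
  · simp only [Fintype.sum_prod_type, ← Finset.mul_sum, ← Finset.sum_mul]
    rw [sum_units_mul_stdAddChar hχ,
      klSum_eq_sum_units, map_mul, ← hw, ZMod.inv_coe_unit, MulChar.inv_apply χ (w⁻¹ : (ZMod a)ˣ),
      Ring.inverse_unit, inv_inv]
    congr 1
    exact Fintype.sum_equiv (Equiv.mulLeft v⁻¹) _ _ fun u => rfl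

lemma coprime_div_qInfGcd {m : ℕ} (hm : 0 < m) (q : ℕ) : (m / qInfGcd m q).Coprime q := by
  refine Nat.coprime_of_dvd fun p hp hpm hpq => ?_
  have hg : qInfGcd m q ∣ m := Nat.gcd_dvd_left _ _
  have h1 : p ^ (m.factorization p) ∣ qInfGcd m q :=
    Nat.dvd_gcd (Nat.ordProj_dvd m p)
      ((pow_dvd_pow_of_dvd hpq _).trans (pow_dvd_pow q (Nat.factorization_lt p hm.ne').le))
  have h2 : p ^ (m.factorization p + 1) ∣ m := by
    rw [pow_succ, ← Nat.mul_div_cancel' hg]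
    exact mul_dvd_mul (by rwa [Nat.mul_div_cancel' hg]) hpm
  exact Nat.pow_succ_factorization_not_dvd hm.ne' hp h2

lemma sum_moebius_ite_dvd {q : ℕ} (hq : q ≠ 0) (b : ℕ) :
    ∑ d ∈ q.divisors, (if d ∣ b then (ArithmeticFunction.moebius d : ℂ) else 0) =
      if b.Coprime q then 1 else 0 := by
  have h := congrArg (fun f : ArithmeticFunction ℤ => f (Nat.gcd b q))
    ArithmeticFunction.moebius_mul_coe_zeta
  simp only [ArithmeticFunction.coe_mul_zeta_apply, ArithmeticFunction.one_apply] at h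
  have hd : (q.divisors.filter (· ∣ b)) = (Nat.gcd b q).divisors := by
    ext d
    simp [Nat.dvd_gcd_iff, hq, and_comm]
  rw [← Finset.sum_filter, hd]
  simp only [Nat.Coprime]
  exact_mod_cast h

lemma sum_moebius_mul_tsum {q a : ℕ} (hq : q ≠ 0) (ha : a ≠ 0) (G : ℕ → ℂ) (N : ℕ)
    (hG : ∀ b, N ≤ b → G (a * b) = 0) :
    ∑ d ∈ q.divisors, (ArithmeticFunction.moebius d : ℂ) *
      ∑' c : ℕ, (if 1 ≤ c ∧ d * a ∣ c then G c else 0) =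
    ∑ b ∈ Finset.range N, if 1 ≤ b ∧ b.Coprime q then G (a * b) else 0 := by
  have h1 (d : ℕ) : ∑' c : ℕ, (if 1 ≤ c ∧ d * a ∣ c then G c else 0) =
      ∑ b ∈ Finset.range N, if 1 ≤ b ∧ d ∣ b then G (a * b) else 0 := by
    rw [← (mul_right_injective₀ ha).tsum_eq]
    · rw [tsum_eq_sum (s := Finset.range N)]
      · refine Finset.sum_congr rfl fun b _ => if_congr ?_ rfl rfl
        rw [mul_comm d a, Nat.mul_dvd_mul_iff_left (Nat.pos_of_ne_zero ha)]
        simp [Nat.one_le_iff_ne_zero, ha]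
      · intro b hb
        simp [hG b (by simpa using hb)]
    · intro c hc
      obtain ⟨k, hk⟩ : a ∣ c := by
        by_contra h
        exact hc (if_neg fun h' => h ((dvd_mul_left a d).trans h'.2))
      exact ⟨k, hk.symm⟩
  simp only [h1, Finset.mul_sum]
  rw [Finset.sum_comm]
  refine Finset.sum_congr rfl fun b _ => ?_
  by_cases hb : 1 ≤ b
  · trans (∑ d ∈ q.divisors, if d ∣ b then (ArithmeticFunction.moebius d : ℂ) else 0) * G (a * b)
    · simp [hb, Finset.sum_mul]
    · rw [sum_moebius_ite_dvd hq]
      simp [hb]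
  · simp [hb]

/-- Mellin inversion on `(ℤ/qℤ)ˣ`. -/
lemma qMellin_inversion (q : ℕ) [NeZero q] (f : (ZMod q)ˣ → ℂ) (u : (ZMod q)ˣ) :
    ((q.totient : ℝ) ^ (-(1/2) : ℝ) : ℝ) *
      ∑ χ : DirichletCharacter ℂ q, qMellin q f χ * χ u = f u := by
  have hφ : (0 : ℝ) < q.totient := by exact_mod_cast Nat.totient_pos.2 (NeZero.pos q)
  have h (c : (ZMod q)ˣ) : ∑ χ : DirichletCharacter ℂ q, (starRingEnd ℂ) (χ c) * χ u =
      if c = u then (q.totient : ℂ) else 0 := by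
    have := DirichletCharacter.sum_char_inv_mul_char_eq ℂ c.isUnit (u : ZMod q)
    simp only [Units.val_inj] at this
    rw [← this]
    refine Finset.sum_congr rfl fun χ _ => ?_
    rw [starRingEnd_apply, MulChar.star_apply', MulChar.inv_apply, Ring.inverse_unit,
      ZMod.inv_coe_unit]
  have hr : ((q.totient : ℝ) ^ (-(1/2) : ℝ)) * ((q.totient : ℝ) ^ (-(1/2) : ℝ)) * q.totient = 1 := by
    rw [← Real.rpow_add hφ]
    norm_num
    rw [Real.rpow_neg_one, inv_mul_cancel₀ hφ.ne']
  have hr' := congrArg (Complex.ofReal) hr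
  push_cast at hr'
  have hsum : ∑ χ : DirichletCharacter ℂ q, (∑ c : (ZMod q)ˣ, (starRingEnd ℂ) (χ c) * f c) * χ u =
      q.totient * f u := by
    simp only [Finset.sum_mul, mul_right_comm _ (f _)]
    rw [Finset.sum_comm]
    simp only [← Finset.sum_mul, h]
    simp
  simp only [qMellin, mul_assoc, ← Finset.mul_sum]
  rw [hsum]
  linear_combination f u * hr'

lemma primitiveCharacter_apply_of_coprime {q : ℕ} (χ : DirichletCharacter ℂ q) {b : ℕ}
    (hb : b.Coprime q) : χ.primitiveCharacter b = χ b := by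
  simpa using χ.primitiveCharacter_apply_of_isCoprime (Nat.isCoprime_iff_coprime.2 hb)

/-- The basic identity: with `m' = m/(m,q^∞)`, `n' = n(m,q^∞)`, and for each `χ` mod `q`
its inducing primitive character `χ₁` of conductor `q₁`,
`Σ_{(c,q)=1} S(m,n,c) c^{-1/2} f(c) f_∞(c/X)
  = φ(q)^{-1/2} Σ_{χ (q)} (χ(m') f̂(χ)/τ(χ₁)) Σ_{d∣q} μ(d)
      Σ_{dq₁∣c} (q₁^{1/2}/c^{1/2}) S_{χ₁}(m',n'q₁²,c) f_∞(c/(q₁X))`. -/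
theorem basic_identity
    (m n q : ℕ) [NeZero q] (hm : 0 < m) (hn : 0 < n) (hq : 0 < q)
    (X : ℝ) (hX : 0 < X) (f : (ZMod q)ˣ → ℂ)
    (f_inf : ℝ → ℂ) (hsmooth : ContDiff ℝ (⊤ : ℕ∞) f_inf) (hcpt : HasCompactSupport f_inf)
    (hsupp : tsupport f_inf ⊆ Set.Ioi 0) :
    (∑' c : ℕ, if h : 1 ≤ c ∧ Nat.Coprime c q then
        klSum (m : ℤ) (n : ℤ) c / ((c : ℝ) ^ ((1:ℝ)/2) : ℝ) *
          f (ZMod.unitOfCoprime c h.2) * f_inf ((c : ℝ) / X)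
      else 0) =
    ((q.totient : ℝ) ^ (-(1/2) : ℝ) : ℝ) *
      ∑' χ : DirichletCharacter ℂ q,
        χ (((m / qInfGcd m q : ℕ) : ZMod q)) * qMellin q f χ / gaussS χ.primitiveCharacter *
          ∑ d ∈ q.divisors, (ArithmeticFunction.moebius d : ℂ) *
            ∑' c : ℕ, if 1 ≤ c ∧ d * χ.conductor ∣ c then
              (((χ.conductor : ℝ) ^ ((1:ℝ)/2) / (c : ℝ) ^ ((1:ℝ)/2) : ℝ) : ℂ) *
                klSumTwist χ.primitiveCharacter ((m / qInfGcd m q : ℕ) : ℤ)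
                  (((n * qInfGcd m q : ℕ) : ℤ) * (χ.conductor : ℤ) ^ 2) c *
                f_inf ((c : ℝ) / (χ.conductor * X))
            else 0 := by
  obtain ⟨N, hN⟩ : ∃ N : ℕ, ∀ c : ℕ, N ≤ c → f_inf ((c : ℝ) / X) = 0 := by
    obtain ⟨B, hB⟩ := hcpt.isCompact.bddAbove
    obtain ⟨N, hN⟩ := exists_nat_gt (B * X)
    refine ⟨N, fun c hc => ?_⟩
    by_contra h
    have h1 : (c : ℝ) / X ≤ B := hB (subset_tsupport _ h)
    rw [div_le_iff₀ hX] at h1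
    have h2 : (N : ℝ) ≤ c := by exact_mod_cast hc
    linarith
  have hm' : (m / qInfGcd m q).Coprime q := coprime_div_qInfGcd hm q
  have hg : qInfGcd m q ∣ m := Nat.gcd_dvd_left _ _
  set g := qInfGcd m q
  have key (χ : DirichletCharacter ℂ q) :
      χ ((m / g : ℕ) : ZMod q) * qMellin q f χ / gaussS χ.primitiveCharacter *
          ∑ d ∈ q.divisors, (ArithmeticFunction.moebius d : ℂ) *
            ∑' c : ℕ, (if 1 ≤ c ∧ d * χ.conductor ∣ c then
              (((χ.conductor : ℝ) ^ ((1:ℝ)/2) / (c : ℝ) ^ ((1:ℝ)/2) : ℝ) : ℂ) *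
                klSumTwist χ.primitiveCharacter ((m / g : ℕ) : ℤ)
                  (((n * g : ℕ) : ℤ) * (χ.conductor : ℤ) ^ 2) c *
                f_inf ((c : ℝ) / (χ.conductor * X))
            else 0) =
      ∑ b ∈ Finset.range N, if 1 ≤ b ∧ b.Coprime q then
        klSum m n b / ((b : ℝ) ^ ((1:ℝ)/2) : ℝ) * f_inf ((b : ℝ) / X) *
          (qMellin q f χ * χ b) else 0 := by
    have ha : χ.conductor ≠ 0 := χ.conductor_ne_zero
    have : NeZero χ.conductor := ⟨ha⟩
    have ha0 : (0 : ℝ) < χ.conductor := by exact_mod_cast Nat.pos_of_ne_zero ha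
    have hdiv (b : ℕ) : ((χ.conductor * b : ℕ) : ℝ) / (χ.conductor * X) = b / X := by
      push_cast
      exact mul_div_mul_left _ _ ha0.ne'
    rw [sum_moebius_mul_tsum hq.ne' ha (fun c =>
      (((χ.conductor : ℝ) ^ ((1:ℝ)/2) / (c : ℝ) ^ ((1:ℝ)/2) : ℝ) : ℂ) *
        klSumTwist χ.primitiveCharacter ((m / g : ℕ) : ℤ)
          (((n * g : ℕ) : ℤ) * (χ.conductor : ℤ) ^ 2) c *
        f_inf ((c : ℝ) / (χ.conductor * X))) N fun b hb => by simp only [hdiv, hN b hb, mul_zero],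
      Finset.mul_sum]
    refine Finset.sum_congr rfl fun b _ => ?_
    split_ifs with hb
    · obtain ⟨hb1, hbq⟩ := hb
      have : NeZero b := ⟨by omega⟩
      have hcop : χ.conductor.Coprime b := (hbq.coprime_dvd_right χ.conductor_dvd_level).symm
      have hgb : IsUnit (((g : ℕ) : ℤ) : ZMod b) := by
        rw [Int.cast_natCast, ZMod.isUnit_iff_coprime]
        exact (hbq.symm.pow_left m).coprime_dvd_left (Nat.gcd_dvd_right _ _)
      have hkl : klSum ((m / g : ℕ) : ℤ) ((n * g : ℕ) : ℤ) b = klSum m n b := by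
        rw [Nat.cast_mul, ← klSum_mul_comm _ _ _ _ hgb, ← Nat.cast_mul, Nat.div_mul_cancel hg]
      have hroot : (χ.conductor : ℝ) ^ ((1:ℝ)/2) / ((χ.conductor * b : ℕ) : ℝ) ^ ((1:ℝ)/2) =
          ((b : ℝ) ^ ((1:ℝ)/2))⁻¹ := by
        rw [Nat.cast_mul, Real.mul_rpow ha0.le b.cast_nonneg, ← div_div,
          div_self (Real.rpow_pos_of_pos ha0 _).ne', one_div]
      have hχm : χ ((m / g : ℕ) : ZMod q) ≠ 0 :=
        ((((ZMod.isUnit_iff_coprime _ _).2 hm')).map χ).ne_zero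
      have hτ : gaussS χ.primitiveCharacter ≠ 0 :=
        gaussS_ne_zero χ.primitiveCharacter_isPrimitive
      simp only [hdiv, hroot]
      rw [klSumTwist_mul_of_coprime hcop χ.primitiveCharacter_isPrimitive, hkl,
        MulChar.inv_apply_eq_inv', Int.cast_natCast, primitiveCharacter_apply_of_coprime χ hm',
        primitiveCharacter_apply_of_coprime χ hbq]
      push_cast
      field_simp
    · rw [mul_zero]
  simp only [key]
  rw [tsum_fintype (L := .unconditional (DirichletCharacter ℂ q))]
  rw [Finset.sum_comm, Finset.mul_sum, tsum_eq_sum (s := Finset.range N)]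
  · refine Finset.sum_congr rfl fun b _ => ?_
    split_ifs with hb
    · rw [← Finset.mul_sum, mul_left_comm, ← ZMod.coe_unitOfCoprime b hb.2, qMellin_inversion]
      ring
    · simp
  · intro b hb
    simp [hN b (by simpa using hb)]
end
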